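/- arXiv:2210.03410 — 3 statements merged into one kernel-verified Lean document; each statement's English description precedes it below -/
import Mathlib

section
/- For all odd positive integers n and d with d ≤ n, hmin(n, d) = ⌈((d+1)/2) · max{ (n+1)/(2d), 1 }⌉ + [(n, d) ∈ {(5, 3), (9, 5)}], where [·] equals 1 if the condition holds and 0 otherwise. -/
open Finset
open scoped Classical

/-- The closed neighborhood `N[v] = {v} ∪ N(v)` of a vertex `v` in a simple graph `G`.
A `d`-regular graph with loops is modeled by a simple graph in which every
closed neighborhood has size `d`. -/
noncomputable def closedNbhd {n : ℕ} (G : SimpleGraph (Fin n)) (v : Fin n) : Finset (Fin n) :=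
  Finset.univ.filter fun u => u = v ∨ G.Adj v u

/-- A configuration with parameters `(n, d, h)`: a simple graph `G` on `n` vertices all
of whose closed neighborhoods have size `d` (i.e. a `d`-regular graph with loops),
together with an opinion function `f : V → {1, -1}` having exactly `h` happy vertices. -/
def IsConfig {n : ℕ} (d h : ℕ) (G : SimpleGraph (Fin n)) (f : Fin n → ℤ) : Prop :=
  (∀ v, (closedNbhd G v).card = d) ∧ (∀ v, f v = 1 ∨ f v = -1) ∧
  (Finset.univ.filter fun v => f v = 1).card = h

/-- The number of proponents: vertices `v` with `∑_{u ∈ N[v]} f u ≥ 1`. -/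
noncomputable def numProponents {n : ℕ} (G : SimpleGraph (Fin n)) (f : Fin n → ℤ) : ℕ :=
  (Finset.univ.filter fun v => 1 ≤ ∑ u ∈ closedNbhd G v, f u).card

/-- A configuration is approving if more than `n/2` of its vertices are proponents. -/
def IsApproving {n : ℕ} (G : SimpleGraph (Fin n)) (f : Fin n → ℤ) : Prop :=
  2 * numProponents G f > n

/-- `hmin n d`: the least `h` for which an approving configuration with parameters
`(n, d, h)` exists. -/
noncomputable def hmin (n d : ℕ) : ℕ :=
  sInf {h : ℕ | ∃ (G : SimpleGraph (Fin n)) (f : Fin n → ℤ), IsConfig d h G f ∧ IsApproving G f}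

/-- `hmax n d`: the greatest `h ≤ n` for which a disapproving configuration with parameters
`(n, d, h)` exists. -/
noncomputable def hmax (n d : ℕ) : ℕ :=
  sSup {h : ℕ | h ≤ n ∧
    ∃ (G : SimpleGraph (Fin n)) (f : Fin n → ℤ), IsConfig d h G f ∧ ¬ IsApproving G f}

/-- `hminN n`: the minimum of `hmin n d` over odd `d` with `1 ≤ d ≤ n`. -/
noncomputable def hminN (n : ℕ) : ℕ :=
  sInf {m : ℕ | ∃ d : ℕ, Odd d ∧ 1 ≤ d ∧ d ≤ n ∧ m = hmin n d}

section Feasibility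

variable {V W : Type*} [Fintype V] [Fintype W]

/-- The closed neighborhood of a vertex, over an arbitrary finite vertex type. -/
noncomputable def closedNbr (G : SimpleGraph V) (v : V) : Finset V :=
  Finset.univ.filter fun u => u = v ∨ G.Adj v u

/-- The vertices of `H` in the closed neighborhood of `v`. -/
noncomputable def happyNbr (G : SimpleGraph V) (H : Finset V) (v : V) : Finset V :=
  H.filter fun u => u ∈ closedNbr G v

lemma mem_closedNbr {G : SimpleGraph V} {u v : V} :
    u ∈ closedNbr G v ↔ u = v ∨ G.Adj v u := by
  simp [closedNbr]

lemma mem_happyNbr {G : SimpleGraph V} {H : Finset V} {u v : V} :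
    u ∈ happyNbr G H v ↔ u ∈ H ∧ (u = v ∨ G.Adj v u) := by
  simp [happyNbr, mem_closedNbr]

lemma mem_closedNbr_comm {G : SimpleGraph V} {u v : V} :
    u ∈ closedNbr G v ↔ v ∈ closedNbr G u := by
  simp [mem_closedNbr, eq_comm, G.adj_comm]

variable (V) in
/-- Some approving configuration with parameters `(card V, d, h)` exists on `V`. The happy
vertices form `H`, and `P` is a majority consisting of proponents. -/
def Feasible (d h : ℕ) : Prop :=
  ∃ (G : SimpleGraph V) (H P : Finset V), (∀ v, #(closedNbr G v) = d) ∧ #H = h ∧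
    Fintype.card V < 2 * #P ∧ ∀ v ∈ P, d < 2 * #(happyNbr G H v)

lemma Feasible.of_equiv {d h : ℕ} (e : V ≃ W) (hV : Feasible V d h) : Feasible W d h := by
  obtain ⟨G, H, P, hG, hH, hP, hPH⟩ := hV
  refine ⟨G.comap e.symm, H.map e.toEmbedding, P.map e.toEmbedding, fun v => ?_, by simpa,
    by simpa [← Fintype.card_congr e] using hP, fun v hv => ?_⟩
  · have : closedNbr (G.comap e.symm) v = (closedNbr G (e.symm v)).map e.toEmbedding := by
      ext u
      simp [mem_closedNbr, Finset.mem_map_equiv]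
    rw [this, card_map, hG]
  · have : happyNbr (G.comap e.symm) (H.map e.toEmbedding) v =
        (happyNbr G H (e.symm v)).map e.toEmbedding := by
      ext u
      simp [mem_happyNbr, Finset.mem_map_equiv]
    rw [this, card_map]
    exact hPH _ (by simpa [Finset.mem_map_equiv] using hv)

lemma Feasible.fin {n d h : ℕ} (hV : Feasible V d h) (hn : Fintype.card V = n) :
    Feasible (Fin n) d h :=
  hV.of_equiv (Fintype.equivFinOfCardEq hn)

end Feasibility

lemma closedNbhd_eq_closedNbr {n : ℕ} (G : SimpleGraph (Fin n)) (v : Fin n) :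
    closedNbhd G v = closedNbr G v := by
  ext u
  simp [closedNbhd, mem_closedNbr]

lemma sum_closedNbhd {n : ℕ} (G : SimpleGraph (Fin n)) (f : Fin n → ℤ)
    (hf : ∀ v, f v = 1 ∨ f v = -1) (v : Fin n) :
    ∑ u ∈ closedNbhd G v, f u =
      2 * (#(happyNbr G (univ.filter fun v => f v = 1) v) : ℤ) - #(closedNbhd G v) := by
  have h1 : happyNbr G (univ.filter fun v => f v = 1) v =
      (closedNbhd G v).filter fun u => f u = 1 := by
    ext u
    simp [mem_happyNbr, closedNbhd, and_comm]
  have h2 : ∀ u, f u = 2 * (if f u = 1 then 1 else 0) - 1 := by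
    intro u
    rcases hf u with h | h <;> simp [h]
  rw [h1, sum_congr rfl fun u _ => h2 u, sum_sub_distrib, ← mul_sum, sum_boole]
  simp

lemma exists_config_iff_feasible {n d h : ℕ} :
    (∃ (G : SimpleGraph (Fin n)) (f : Fin n → ℤ), IsConfig d h G f ∧ IsApproving G f) ↔
      Feasible (Fin n) d h := by
  constructor
  · rintro ⟨G, f, ⟨hG, hf, hh⟩, hA⟩
    refine ⟨G, univ.filter fun v => f v = 1,
      univ.filter fun v => 1 ≤ ∑ u ∈ closedNbhd G v, f u,
      fun v => by rw [← closedNbhd_eq_closedNbr, hG], hh, ?_, fun v hv => ?_⟩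
    · simpa [IsApproving, numProponents] using hA
    · have h1 := (mem_filter.1 hv).2
      rw [sum_closedNbhd G f hf, hG] at h1
      omega
  · rintro ⟨G, H, P, hG, hH, hP, hPH⟩
    set f : Fin n → ℤ := fun v => if v ∈ H then 1 else -1 with hfdef
    have hfH : (univ.filter fun v => f v = 1) = H := by
      ext v
      by_cases hv : v ∈ H <;> simp [hfdef, hv]
    have hf : ∀ v, f v = 1 ∨ f v = -1 := by
      intro v
      by_cases hv : v ∈ H <;> simp [hfdef, hv]
    have hG' : ∀ v, #(closedNbhd G v) = d := fun v => by rw [closedNbhd_eq_closedNbr, hG]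
    refine ⟨G, f, ⟨hG', hf, by rw [hfH, hH]⟩, ?_⟩
    have hsub : P ⊆ univ.filter fun v => 1 ≤ ∑ u ∈ closedNbhd G v, f u := by
      intro v hv
      have h1 := hPH v hv
      rw [mem_filter, sum_closedNbhd G f hf, hfH, hG']
      exact ⟨mem_univ v, by omega⟩
    have := card_le_card hsub
    rw [Fintype.card_fin] at hP
    unfold IsApproving numProponents
    omega

lemma hmin_eq_of_isLeast {n d h : ℕ} (hh : IsLeast {h | Feasible (Fin n) d h} h) :
    hmin n d = h := by
  unfold hmin
  simp only [exists_config_iff_feasible]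
  exact hh.csInf_eq

section LowerBound

variable {V : Type*} [Fintype V]

lemma Feasible.lt_two_mul {d h : ℕ} (hV : Feasible V d h) : d < 2 * h := by
  obtain ⟨G, H, P, -, rfl, hP, hPH⟩ := hV
  have : P.Nonempty := by
    rw [← card_pos]
    omega
  obtain ⟨v, hv⟩ := this
  have h1 := hPH v hv
  have h2 : #(happyNbr G H v) ≤ #H := card_le_card (filter_subset _ _)
  omega

lemma Feasible.mul_le {k m h : ℕ} (hV : Feasible V (2 * k + 1) h)
    (hcard : Fintype.card V = 2 * m + 1) : (m + 1) * (k + 1) ≤ h * (2 * k + 1) := by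
  obtain ⟨G, H, P, hG, rfl, hP, hPH⟩ := hV
  calc (m + 1) * (k + 1) ≤ #P * (k + 1) := Nat.mul_le_mul_right _ (by omega)
    _ ≤ #H * (2 * k + 1) := by
      refine card_mul_le_card_mul (fun v u => u ∈ closedNbr G v) (fun v hv => ?_) fun u _ => ?_
      · have := hPH v hv
        have h2 : #(happyNbr G H v) = #(bipartiteAbove (fun v u => u ∈ closedNbr G v) H v) := by
          congr 1
        omega
      · rw [← hG u]
        refine card_le_card fun v hv => ?_
        exact mem_closedNbr_comm.1 (mem_bipartiteBelow _ |>.1 hv).2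

/-- When `n = 2d - 1`, the value `h = (d + 1) / 2` forces the closed neighborhood of every happy
vertex to be the set of proponents, and counting edges between opponents and sad proponents
excludes `d = 3` and `d = 5`. -/
lemma Feasible.le_mul_pred {k : ℕ} (hV : Feasible V (2 * k + 1) (k + 1))
    (hcard : Fintype.card V = 4 * k + 1) : 2 * k ≤ k * (k - 1) := by
  obtain ⟨G, H, P, hG, hH, hP, hPH⟩ := hV
  have hsubH : ∀ v ∈ P, H ⊆ closedNbr G v := by
    intro v hv u hu
    have h1 := hPH v hv
    have h2 : happyNbr G H v = H := eq_of_subset_of_card_le (filter_subset _ _) (by omega)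
    rw [← h2] at hu
    exact (mem_filter.1 hu).2
  have hHP : ∀ u ∈ H, P = closedNbr G u := by
    intro u hu
    refine eq_of_subset_of_card_le (fun v hv => mem_closedNbr_comm.1 (hsubH v hv hu)) ?_
    rw [hG]
    omega
  have hHne : H.Nonempty := card_pos.1 (by omega)
  obtain ⟨u₀, hu₀⟩ := hHne
  have hPcard : #P = 2 * k + 1 := by rw [hHP u₀ hu₀, hG]
  have hHsub : H ⊆ P := fun u hu => by
    rw [hHP u hu]
    exact mem_closedNbr.2 (Or.inl rfl)
  have hR : #(P \ H) = k := by
    rw [card_sdiff_of_subset hHsub]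
    omega
  have hQ : #Pᶜ = 2 * k := by
    rw [card_compl]
    omega
  have key : #Pᶜ * 1 ≤ #(P \ H) * (k - 1) := by
    refine card_mul_le_card_mul (fun q r => r ∈ closedNbr G q) (fun q hq => ?_) fun r hr => ?_
    · rw [Nat.one_le_iff_ne_zero, card_ne_zero]
      by_contra hne
      rw [not_nonempty_iff_eq_empty] at hne
      have hsub : closedNbr G q ⊆ Pᶜ := by
        intro r hr
        rw [mem_compl]
        intro hrP
        by_cases hrH : r ∈ H
        · rw [mem_compl, hHP r hrH] at hq
          exact hq (mem_closedNbr_comm.1 hr)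
        · have : r ∈ bipartiteAbove (fun q r => r ∈ closedNbr G q) (P \ H) q := by
            rw [mem_bipartiteAbove]
            exact ⟨mem_sdiff.2 ⟨hrP, hrH⟩, hr⟩
          rw [hne] at this
          simp at this
      have := card_le_card hsub
      rw [hG] at this
      omega
    · rw [mem_sdiff] at hr
      have hins : insert r H ⊆ closedNbr G r :=
        insert_subset (mem_closedNbr.2 (Or.inl rfl)) (hsubH r hr.1)
      have hsub : bipartiteBelow (fun q r => r ∈ closedNbr G q) Pᶜ r ⊆
          closedNbr G r \ insert r H := by
        intro q hq
        rw [mem_bipartiteBelow, mem_compl] at hq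
        refine mem_sdiff.2 ⟨mem_closedNbr_comm.1 hq.2, fun hmem => hq.1 ?_⟩
        rcases mem_insert.1 hmem with rfl | h
        · exact hr.1
        · exact hHsub h
      have := card_le_card hsub
      rw [card_sdiff_of_subset hins, card_insert_of_notMem hr.2, hG] at this
      omega
  rwa [hR, hQ, mul_one] at key

end LowerBound

section Circulant

/-- The circulant graph on `ZMod p` joining vertices at cyclic distance at most `k`. -/
def cyclePower (p k : ℕ) : SimpleGraph (ZMod p) where
  Adj u v := u ≠ v ∧ ∃ j : ℕ, j < 2 * k + 1 ∧ v = u + j - k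
  symm := ⟨by
    rintro u v ⟨hne, j, hj, rfl⟩
    refine ⟨hne.symm, 2 * k - j, by omega, ?_⟩
    rw [Nat.cast_sub (by omega)]
    push_cast
    ring⟩
  loopless := ⟨fun u h => h.1 rfl⟩

lemma injOn_cyclePower {p k : ℕ} (hk : 2 * k + 1 ≤ p) (v : ZMod p) :
    Set.InjOn (fun j : ℕ => v + j - k) (range (2 * k + 1)) := by
  intro i hi j hj hij
  simp only [coe_range, Set.mem_Iio] at hi hj
  have h1 : (i : ZMod p) = j := by simpa using hij
  rw [ZMod.natCast_eq_natCast_iff', Nat.mod_eq_of_lt (by omega), Nat.mod_eq_of_lt (by omega)] at h1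
  exact h1

lemma closedNbr_cyclePower {p : ℕ} [NeZero p] (k : ℕ) (v : ZMod p) :
    closedNbr (cyclePower p k) v = (range (2 * k + 1)).image fun j : ℕ => v + j - k := by
  ext u
  simp only [mem_closedNbr, mem_image, mem_range, cyclePower]
  constructor
  · rintro (rfl | ⟨-, j, hj, rfl⟩)
    · exact ⟨k, by omega, by ring⟩
    · exact ⟨j, hj, rfl⟩
  · rintro ⟨j, hj, rfl⟩
    by_cases h : v = v + j - k
    · exact Or.inl h.symm
    · exact Or.inr ⟨h, j, hj, rfl⟩

lemma card_closedNbr_cyclePower {p k : ℕ} [NeZero p] (hk : 2 * k + 1 ≤ p) (v : ZMod p) :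
    #(closedNbr (cyclePower p k) v) = 2 * k + 1 := by
  rw [closedNbr_cyclePower, card_image_of_injOn (injOn_cyclePower hk v), card_range]

/-- The balanced word of slope `h / p`. -/
def balancedWord (p h i : ℕ) : ℕ := (i + 1) * h / p - i * h / p

lemma balancedWord_le_one {p h : ℕ} (hp : 0 < p) (hh : h ≤ p) (i : ℕ) :
    balancedWord p h i ≤ 1 := by
  have : (i + 1) * h / p ≤ (i * h + p) / p := Nat.div_le_div_right (by nlinarith)
  rw [Nat.add_div_right _ hp] at this
  unfold balancedWord
  omega

lemma balancedWord_mod {p : ℕ} (hp : 0 < p) (h i : ℕ) :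
    balancedWord p h (i % p) = balancedWord p h i := by
  conv_rhs => rw [← Nat.mod_add_div i p]
  unfold balancedWord
  rw [show (i % p + p * (i / p) + 1) * h = (i % p + 1) * h + p * (i / p * h) by ring,
    show (i % p + p * (i / p)) * h = i % p * h + p * (i / p * h) by ring,
    Nat.add_mul_div_left _ _ hp, Nat.add_mul_div_left _ _ hp]
  omega

lemma sum_balancedWord (p h s L : ℕ) :
    ∑ j ∈ range L, balancedWord p h (s + j) = (s + L) * h / p - s * h / p := by
  induction L with
  | zero => simp
  | succ L ih =>
    rw [sum_range_succ, ih, balancedWord]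
    have h1 : s * h / p ≤ (s + L) * h / p :=
      Nat.div_le_div_right (Nat.mul_le_mul_right _ (by omega))
    have h2 : (s + L) * h / p ≤ (s + L + 1) * h / p :=
      Nat.div_le_div_right (Nat.mul_le_mul_right _ (by omega))
    rw [← add_assoc]
    omega

lemma card_filter_balancedWord {p h : ℕ} (hp : 0 < p) (hh : h ≤ p) (s L : ℕ) :
    #((range L).filter fun j => balancedWord p h (s + j) = 1) =
      (s + L) * h / p - s * h / p := by
  rw [← sum_balancedWord, card_filter]
  refine sum_congr rfl fun j _ => ?_
  have := balancedWord_le_one hp hh (s + j)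
  split_ifs <;> omega

/-- If `p (k + 1) ≤ h (2k + 1)`, then some `h` vertices of the circulant graph meet every closed
neighborhood in at least `k + 1` vertices. -/
lemma exists_balanced_finset {p k h : ℕ} [NeZero p] (hk : 2 * k + 1 ≤ p) (hh : h ≤ p)
    (hph : p * (k + 1) ≤ h * (2 * k + 1)) :
    ∃ H : Finset (ZMod p), #H = h ∧ ∀ v, k + 1 ≤ #(happyNbr (cyclePower p k) H v) := by
  have hp : 0 < p := by omega
  refine ⟨univ.filter fun x => balancedWord p h x.val = 1, ?_, fun v => ?_⟩
  · have himg : (univ.filter fun x : ZMod p => balancedWord p h x.val = 1) =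
        ((range p).filter fun j => balancedWord p h (0 + j) = 1).image
          fun j : ℕ => (j : ZMod p) := by
      ext x
      simp only [mem_filter, mem_univ, true_and, mem_image, mem_range, zero_add]
      constructor
      · exact fun hx => ⟨x.val, ⟨ZMod.val_lt x, hx⟩, by simp⟩
      · rintro ⟨j, ⟨hj, hj1⟩, rfl⟩
        rwa [ZMod.val_cast_of_lt hj]
    rw [himg, card_image_of_injOn, card_filter_balancedWord hp hh]
    · simp [hp]
    · intro i hi j hj hij
      simp only [coe_filter, mem_range, Set.mem_ofPred_eq] at hi hj
      have h1 : (i : ZMod p) = j := hij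
      rwa [ZMod.natCast_eq_natCast_iff', Nat.mod_eq_of_lt hi.1, Nat.mod_eq_of_lt hj.1] at h1
  · set s := v.val + p - k with hs
    have hcast : ∀ j : ℕ, ((s + j : ℕ) : ZMod p) = v + j - k := by
      intro j
      rw [hs, Nat.cast_add, Nat.cast_sub (by omega)]
      push_cast
      rw [ZMod.natCast_zmod_val, ZMod.natCast_self]
      ring
    have hsub : ((range (2 * k + 1)).filter fun j => balancedWord p h (s + j) = 1).image
        (fun j : ℕ => v + j - k) ⊆
        happyNbr (cyclePower p k) (univ.filter fun x => balancedWord p h x.val = 1) v := by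
      intro x hx
      obtain ⟨j, hj, rfl⟩ := mem_image.1 hx
      rw [mem_filter] at hj
      rw [mem_happyNbr, ← mem_closedNbr, closedNbr_cyclePower]
      refine ⟨?_, mem_image_of_mem _ hj.1⟩
      rw [mem_filter, ← hcast, ZMod.val_natCast, balancedWord_mod hp]
      exact ⟨mem_univ _, hj.2⟩
    refine le_trans ?_ (card_le_card hsub)
    rw [card_image_of_injOn ((injOn_cyclePower hk v).mono (coe_subset.2 (filter_subset _ _))),
      card_filter_balancedWord hp hh]
    have h1 : s * h / p + (k + 1) ≤ (s + (2 * k + 1)) * h / p := by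
      rw [← Nat.add_mul_div_left _ _ hp]
      exact Nat.div_le_div_right (by nlinarith)
    omega

end Circulant

section Constructions

open SimpleGraph

lemma card_closedNbr_sum {V W : Type*} [Fintype V] [Fintype W] {G : SimpleGraph V}
    {G' : SimpleGraph W} {d : ℕ} (hG : ∀ v, #(closedNbr G v) = d)
    (hG' : ∀ v, #(closedNbr G' v) = d) (v : V ⊕ W) : #(closedNbr (G ⊕g G') v) = d := by
  rcases v with v | v
  · have : closedNbr (G ⊕g G') (Sum.inl v) = (closedNbr G v).map .inl := by
      ext (u | u) <;> simp [mem_closedNbr]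
    rw [this, card_map, hG]
  · have : closedNbr (G ⊕g G') (Sum.inr v) = (closedNbr G' v).map .inr := by
      ext (u | u) <;> simp [mem_closedNbr]
    rw [this, card_map, hG']

lemma card_closedNbr_compl {V : Type*} [Fintype V] {G : SimpleGraph V} {d : ℕ}
    (hG : ∀ v, #(closedNbr G v) = d) (v : V) :
    #(closedNbr Gᶜ v) = Fintype.card V - (d - 1) := by
  have h1 : closedNbr Gᶜ v = ((closedNbr G v).erase v)ᶜ := by
    ext u
    simp only [mem_closedNbr, compl_adj, mem_compl, mem_erase]
    by_cases h : u = v <;> simp [h]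
    tauto
  rw [h1, card_compl, card_erase_of_mem (mem_closedNbr.2 (Or.inl rfl)), hG]

/-- Large orders: two disjoint circulant graphs, of which the larger one has all proponents. -/
lemma feasible_of_two_mul_lt {k m h : ℕ} (hm : 2 * k + 1 ≤ m) (hh : h ≤ m + 1)
    (hmh : (m + 1) * (k + 1) ≤ h * (2 * k + 1)) : Feasible (Fin (2 * m + 1)) (2 * k + 1) h := by
  have : NeZero m := ⟨by omega⟩
  obtain ⟨H, hH, hHv⟩ := exists_balanced_finset (by omega) hh hmh
  refine Feasible.fin (V := ZMod (m + 1) ⊕ ZMod m)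
    ⟨cyclePower (m + 1) k ⊕g cyclePower m k, H.map .inl, univ.map .inl,
      card_closedNbr_sum (card_closedNbr_cyclePower (by omega)) (card_closedNbr_cyclePower hm),
      by simpa, ?_, ?_⟩ ?_
  · simp [ZMod.card]
    omega
  · intro v hv
    obtain ⟨v, -, rfl⟩ := mem_map.1 hv
    have h1 : happyNbr (cyclePower (m + 1) k ⊕g cyclePower m k) (H.map .inl) (Sum.inl v) =
        (happyNbr (cyclePower (m + 1) k) H v).map .inl := by
      ext (u | u) <;> simp [mem_happyNbr]
    have h2 := hHv v
    simp only [Function.Embedding.inl_apply]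
    rw [h1, card_map]
    omega
  · simp [ZMod.card]
    omega

/-- Small orders: the complement of two disjoint circulant graphs, with all happy vertices in the
first part and all vertices of the second part proponents. -/
lemma feasible_of_lt_two_mul {k m : ℕ} (hkm : k < m) (hm : m < 2 * k) :
    Feasible (Fin (2 * m + 1)) (2 * k + 1) (k + 1) := by
  obtain ⟨r, rfl⟩ : ∃ r, m = k + r := ⟨m - k, by omega⟩
  obtain ⟨a, b, hab, hka, hra, hrb, hbm⟩ : ∃ a b : ℕ, a + b = 2 * (k + r) + 1 ∧ k + 1 ≤ a ∧
      2 * r + 1 ≤ a ∧ 2 * r + 1 ≤ b ∧ k + r + 1 ≤ b := by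
    rcases le_total (k + 1) (2 * r + 1) with h | h
    · exact ⟨2 * r + 1, 2 * k, by omega, by omega, by omega, by omega, by omega⟩
    · exact ⟨k + 1, k + 2 * r, by omega, by omega, by omega, by omega, by omega⟩
  have : NeZero a := ⟨by omega⟩
  have : NeZero b := ⟨by omega⟩
  obtain ⟨H, -, hH⟩ := exists_subset_card_eq (s := (univ : Finset (ZMod a))) (n := k + 1)
    (by simpa [ZMod.card])
  have hcard : Fintype.card (ZMod a ⊕ ZMod b) = 2 * (k + r) + 1 := by simpa [ZMod.card]
  refine Feasible.fin (V := ZMod a ⊕ ZMod b)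
    ⟨(cyclePower a r ⊕g cyclePower b r)ᶜ, H.map .inl, univ.map .inr, fun v => ?_, by simpa,
      ?_, ?_⟩ hcard
  · rw [card_closedNbr_compl (card_closedNbr_sum (card_closedNbr_cyclePower hra)
      (card_closedNbr_cyclePower hrb)), hcard]
    omega
  · rw [hcard]
    simp [ZMod.card]
    omega
  · intro v hv
    obtain ⟨v, -, rfl⟩ := mem_map.1 hv
    have h1 : happyNbr (cyclePower a r ⊕g cyclePower b r)ᶜ (H.map .inl)
        (Function.Embedding.inr v) = H.map .inl := by
      ext (u | u) <;> simp [mem_happyNbr]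
    rw [h1, card_map, hH]
    omega

lemma feasible_complete (k : ℕ) : Feasible (Fin (2 * k + 1)) (2 * k + 1) (k + 1) := by
  obtain ⟨H, -, hH⟩ := exists_subset_card_eq (s := (univ : Finset (Fin (2 * k + 1)))) (n := k + 1)
    (by simp; omega)
  refine ⟨⊤, H, univ, fun v => ?_, hH, by simp, fun v _ => ?_⟩
  · have : closedNbr (⊤ : SimpleGraph (Fin (2 * k + 1))) v = univ := by
      ext u
      simp [mem_closedNbr, eq_comm, em]
    simp [this]
  · have : happyNbr (⊤ : SimpleGraph (Fin (2 * k + 1))) H v = H := by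
      ext u
      simp [mem_happyNbr, eq_comm, em]
    rw [this, hH]
    omega

/-- The extremal graph of order `4k + 1`: happy vertices `Fin (k + 1)`, sad proponents `ZMod k`
and opponents `ZMod k × Bool`. The sad proponents induce the complement of a cycle, and each
of them is joined to two opponents. -/
def tightGraph (k : ℕ) : SimpleGraph (Fin (k + 1) ⊕ ZMod k ⊕ ZMod k × Bool) where
  Adj
    | .inl u, .inl v => u ≠ v
    | .inl _, .inr (.inl _) => True
    | .inl _, .inr (.inr _) => False
    | .inr (.inl _), .inl _ => True
    | .inr (.inl i), .inr (.inl j) => i ≠ j ∧ i ≠ j + 1 ∧ j ≠ i + 1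
    | .inr (.inl i), .inr (.inr q) => q.1 = i
    | .inr (.inr _), .inl _ => False
    | .inr (.inr q), .inr (.inl i) => q.1 = i
    | .inr (.inr q), .inr (.inr q') => q ≠ q'
  symm := ⟨by
    rintro (u | i | q) (v | j | q') <;> simp +contextual [eq_comm]⟩
  loopless := ⟨by rintro (u | i | q) <;> simp⟩

lemma card_closedNbr_tightGraph {k : ℕ} [NeZero k] (hk : 3 ≤ k)
    (v : Fin (k + 1) ⊕ ZMod k ⊕ ZMod k × Bool) : #(closedNbr (tightGraph k) v) = 2 * k + 1 := by
  have h1 : (1 : ZMod k) ≠ 0 := by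
    have : Fact (1 < k) := ⟨by omega⟩
    exact one_ne_zero
  have h2 : (1 : ZMod k) + 1 ≠ 0 := by
    intro h
    have h3 : ((2 : ℕ) : ZMod k) = 0 := by
      push_cast
      rw [← one_add_one_eq_two, h]
    rw [ZMod.natCast_eq_zero_iff] at h3
    exact absurd (Nat.le_of_dvd two_pos h3) (by omega)
  rcases v with v | i | q
  · have : closedNbr (tightGraph k) (.inl v) = univ.disjSum (univ.disjSum ∅) := by
      ext (u | j | q) <;> simp [mem_closedNbr, tightGraph, eq_comm, em]
    rw [this]
    simp [ZMod.card]
    omega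
  · have : closedNbr (tightGraph k) (.inr (.inl i)) =
        univ.disjSum (disjSum {i + 1, i - 1}ᶜ {(i, true), (i, false)}) := by
      ext (u | j | ⟨j, b⟩)
      · simp [mem_closedNbr, tightGraph]
      · simp only [mem_closedNbr, tightGraph, inr_mem_disjSum, inl_mem_disjSum, mem_compl,
          mem_insert, mem_singleton, Sum.inr.injEq, Sum.inl.injEq, eq_sub_iff_add_eq]
        by_cases h : j = i
        · subst h
          simp [h1]
        · simp [h, eq_comm]
          tauto
      · cases b <;> simp [mem_closedNbr, tightGraph]
    have hne : i + 1 ≠ i - 1 := by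
      intro h
      apply h2
      linear_combination h
    rw [this, card_disjSum, card_disjSum, card_compl, card_pair hne, card_pair (by simp)]
    simp [ZMod.card]
    omega
  · have : closedNbr (tightGraph k) (.inr (.inr q)) = disjSum ∅ (disjSum {q.1} univ) := by
      ext (u | j | q) <;> simp [mem_closedNbr, tightGraph, eq_comm, em]
    rw [this]
    simp [ZMod.card]
    omega

lemma feasible_tight {k : ℕ} (hk : 3 ≤ k) :
    Feasible (Fin (4 * k + 1)) (2 * k + 1) (k + 1) := by
  have : NeZero k := ⟨by omega⟩
  refine Feasible.fin ⟨tightGraph k, univ.disjSum ∅, univ.disjSum (univ.disjSum ∅),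
    card_closedNbr_tightGraph hk, by simp, by simp [ZMod.card]; omega, fun v hv => ?_⟩
    (by simp [ZMod.card]; omega)
  have hN : happyNbr (tightGraph k) (univ.disjSum ∅) v = univ.disjSum ∅ := by
    ext (u | u)
    · rcases v with v | i | q
      · simp [mem_happyNbr, tightGraph, eq_comm, em]
      · simp [mem_happyNbr, tightGraph]
      · simp at hv
    · simp [mem_happyNbr]
  rw [hN]
  simp
  omega

/-- Feasibility on `Fin n` from a decidable adjacency relation. -/
lemma Feasible.of_decidable {n d h : ℕ} (adj : Fin n → Fin n → Bool)
    (hsymm : ∀ u v, adj u v → adj v u) (hirr : ∀ v, ¬ adj v v) (H P : Finset (Fin n))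
    (hd : ∀ v, #(univ.filter fun u => u = v ∨ adj v u) = d) (hH : #H = h) (hP : n < 2 * #P)
    (hPH : ∀ v ∈ P, d < 2 * #(H.filter fun u => u = v ∨ adj v u)) : Feasible (Fin n) d h := by
  refine ⟨⟨fun u v => adj u v, ⟨hsymm⟩, ⟨hirr⟩⟩, H, P, fun v => ?_, hH, by simpa, fun v hv => ?_⟩
  · rw [← hd v]
    congr 1
    ext u
    simp [mem_closedNbr]
  · refine (hPH v hv).trans_eq ?_
    congr 2
    ext u
    simp [mem_happyNbr]

lemma feasible_five_three : Feasible (Fin 5) 3 3 :=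
  Feasible.of_decidable (fun u v => u = v + 1 ∨ v = u + 1) (by decide) (by decide)
    {0, 1, 2} {0, 1, 2} (by decide) (by decide) (by decide) (by decide)

lemma feasible_nine_five : Feasible (Fin 9) 5 4 :=
  let E : Finset (Fin 9 × Fin 9) := {(0, 1), (0, 2), (0, 3), (1, 2), (1, 3), (4, 0), (4, 1),
    (4, 2), (2, 5), (3, 6), (3, 7), (4, 8), (5, 6), (5, 7), (5, 8), (6, 7), (6, 8), (7, 8)}
  Feasible.of_decidable (fun u v => (u, v) ∈ E ∨ (v, u) ∈ E) (by decide) (by decide)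
    {0, 1, 2, 3} {0, 1, 2, 3, 4} (by decide) (by decide) (by decide) (by decide)

end Constructions

lemma ceil_le_iff (k m : ℕ) (z : ℤ) :
    ⌈(((2 * k + 1 : ℕ) : ℚ) + 1) / 2 *
        max ((((2 * m + 1 : ℕ) : ℚ) + 1) / (2 * ((2 * k + 1 : ℕ) : ℚ))) 1⌉ ≤ z ↔
      (k : ℤ) + 1 ≤ z ∧ ((m : ℤ) + 1) * (k + 1) ≤ z * (2 * k + 1) := by
  have hk : (0 : ℚ) < 2 * k + 1 := by positivity
  have e1 : (((2 * k + 1 : ℕ) : ℚ) + 1) / 2 = k + 1 := by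
    push_cast
    ring
  have e2 : (((2 * m + 1 : ℕ) : ℚ) + 1) / (2 * ((2 * k + 1 : ℕ) : ℚ)) = (m + 1) / (2 * k + 1) := by
    push_cast
    field_simp
    ring
  rw [Int.ceil_le, e1, e2, mul_max_of_nonneg _ _ (by positivity), max_le_iff, mul_one,
    ← mul_div_assoc, div_le_iff₀ hk, and_comm]
  refine and_congr ?_ ?_
  · exact_mod_cast Iff.rfl
  · rw [mul_comm ((k : ℚ) + 1)]
    exact_mod_cast Iff.rfl

/-- Away from the two exceptional pairs, the two counting lower bounds are sharp. -/
lemma feasible_of_bounds {k m c : ℕ} (hkm : k ≤ m)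
    (hex : ¬ (m = 2 * k ∧ (k = 1 ∨ k = 2))) (hc : k + 1 ≤ c)
    (hcm : (m + 1) * (k + 1) ≤ c * (2 * k + 1))
    (hleast : ∀ z, k + 1 ≤ z → (m + 1) * (k + 1) ≤ z * (2 * k + 1) → c ≤ z) :
    Feasible (Fin (2 * m + 1)) (2 * k + 1) c := by
  by_cases h : 2 * k + 1 ≤ m
  · exact feasible_of_two_mul_lt h (hleast _ (by omega) (by nlinarith)) hcm
  have hck : c = k + 1 := le_antisymm (hleast _ le_rfl (by nlinarith)) hc
  subst hck
  rcases hkm.eq_or_lt with rfl | hlt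
  · exact feasible_complete k
  by_cases h2 : m < 2 * k
  · exact feasible_of_lt_two_mul hlt h2
  obtain rfl : m = 2 * k := by omega
  have := feasible_tight (k := k) (by omega)
  rwa [show 2 * (2 * k) + 1 = 4 * k + 1 by ring]

/-- the complete formula for `hmin(n,d)`. -/
theorem stmt12 (n d : ℕ) (hn : Odd n) (hd : Odd d) (hnpos : 0 < n) (hdpos : 0 < d)
    (hdn : d ≤ n) :
    (hmin n d : ℤ) =
      ⌈((d : ℚ) + 1) / 2 * max (((n : ℚ) + 1) / (2 * (d : ℚ))) 1⌉ +
        (if (n = 5 ∧ d = 3) ∨ (n = 9 ∧ d = 5) then 1 else 0) := by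
  obtain ⟨m, rfl⟩ := hn
  obtain ⟨k, rfl⟩ := hd
  have hkm : k ≤ m := by omega
  have hceil := ceil_le_iff k m
  set x : ℤ := ⌈(((2 * k + 1 : ℕ) : ℚ) + 1) / 2 *
    max ((((2 * m + 1 : ℕ) : ℚ) + 1) / (2 * ((2 * k + 1 : ℕ) : ℚ))) 1⌉ with hx
  obtain ⟨hc1, hc2⟩ := (hceil x).1 le_rfl
  clear_value x
  lift x to ℕ using by omega with c
  replace hc1 : k + 1 ≤ c := by exact_mod_cast hc1
  replace hc2 : (m + 1) * (k + 1) ≤ c * (2 * k + 1) := by exact_mod_cast hc2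
  have hle : ∀ z : ℕ, k + 1 ≤ z → (m + 1) * (k + 1) ≤ z * (2 * k + 1) → c ≤ z := by
    intro z h1 h2
    exact_mod_cast (hceil z).2 ⟨by exact_mod_cast h1, by exact_mod_cast h2⟩
  have hlow : ∀ z, Feasible (Fin (2 * m + 1)) (2 * k + 1) z → c ≤ z := by
    intro z hz
    have := hz.lt_two_mul
    exact hle z (by omega) (hz.mul_le (by simp))
  by_cases hex : m = 2 * k ∧ (k = 1 ∨ k = 2)
  · rw [if_pos (by omega)]
    obtain ⟨rfl, hk⟩ := hex
    have hck : c = k + 1 := le_antisymm (hle _ le_rfl (by nlinarith)) hc1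
    subst hck
    have hne : ¬ Feasible (Fin (2 * (2 * k) + 1)) (2 * k + 1) (k + 1) := by
      intro hf
      have := hf.le_mul_pred (by simp; omega)
      rcases hk with rfl | rfl <;> omega
    rw [hmin_eq_of_isLeast (h := k + 1 + 1)]
    · push_cast
      rfl
    refine ⟨?_, fun z hz => ?_⟩
    · rcases hk with rfl | rfl
      · exact feasible_five_three
      · exact feasible_nine_five
    · have h1 := hlow z hz
      have h2 : z ≠ k + 1 := by
        rintro rfl
        exact hne hz
      omega
  · rw [if_neg (by omega), add_zero,
      hmin_eq_of_isLeast ⟨feasible_of_bounds hkm hex hc1 hc2 hle, fun z hz => hlow z hz⟩]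
end

section
/- Let n and d be odd positive integers with d ≤ n, and set M = ⌈((d+1)/2) · max{ (n+1)/(2d), 1 }⌉ + [(n, d) ∈ {(5, 3), (9, 5)}]. Then for every h ∈ {0, 1, …, n}: (i) every configuration with parameters (n, d, h) is disapproving if and only if h < M; (ii) there exist both an approving and a disapproving configuration with parameters (n, d, h) if and only if M ≤ h ≤ n - M; (iii) every configuration with parameters (n, d, h) is approving if and only if h > n - M. -/
open Finset
open scoped Classical

/-! ### Regular graphs with prescribed edge counts between blocks -/

section Blocks

variable {n : ℕ}

/-- The number of neighbors of `v` in `S`. -/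
noncomputable def degIn (G : SimpleGraph (Fin n)) (S : Finset (Fin n)) (v : Fin n) : ℕ :=
  (S.filter fun u => G.Adj v u).card

lemma degIn_of_adj_iff {G G' : SimpleGraph (Fin n)} {x y : Fin n} (hne : x ≠ y)
    (hxy : ¬ G.Adj x y)
    (h : ∀ u v, G'.Adj u v ↔ G.Adj u v ∨ (u = x ∧ v = y) ∨ (u = y ∧ v = x))
    (S : Finset (Fin n)) (w : Fin n) :
    degIn G' S w = degIn G S w + (if w = x ∧ y ∈ S then 1 else 0) +
      (if w = y ∧ x ∈ S then 1 else 0) := by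
  have key : ∀ u, (if G'.Adj w u then 1 else 0) = (if G.Adj w u then 1 else 0) +
      (if w = x ∧ u = y then 1 else 0) + (if w = y ∧ u = x then 1 else 0) := by
    intro u
    have hyx : ¬ G.Adj y x := fun h => hxy h.symm
    by_cases h1 : w = x <;> by_cases h2 : w = y <;> by_cases h3 : u = x <;>
      by_cases h4 : u = y <;> simp_all
  unfold degIn
  rw [card_filter, card_filter, sum_congr rfl fun u _ => key u, sum_add_distrib,
    sum_add_distrib]
  congr 1
  · congr 1
    by_cases h1 : w = x <;> simp [h1]
  · by_cases h1 : w = y <;> simp [h1]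

lemma exists_add_edge (G : SimpleGraph (Fin n)) {x y : Fin n} (hne : x ≠ y)
    (hxy : ¬ G.Adj x y) :
    ∃ G' : SimpleGraph (Fin n), ∀ S w, degIn G' S w = degIn G S w +
      (if w = x ∧ y ∈ S then 1 else 0) + (if w = y ∧ x ∈ S then 1 else 0) := by
  refine ⟨G ⊔ SimpleGraph.edge x y, degIn_of_adj_iff hne hxy fun u v => ?_⟩
  rw [SimpleGraph.sup_adj, SimpleGraph.edge_adj]
  grind

lemma exists_remove_edge (G : SimpleGraph (Fin n)) {x y : Fin n} (hxy : G.Adj x y) :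
    ∃ G' : SimpleGraph (Fin n), (∀ u v, G'.Adj u v → G.Adj u v) ∧
      ∀ S w, degIn G S w = degIn G' S w +
      (if w = x ∧ y ∈ S then 1 else 0) + (if w = y ∧ x ∈ S then 1 else 0) := by
  have hne := hxy.ne
  refine ⟨G \ SimpleGraph.edge x y, fun u v h => h.1, degIn_of_adj_iff hne ?_ fun u v => ?_⟩
  · simp [SimpleGraph.edge_adj, hne]
  · rw [SimpleGraph.sdiff_adj, SimpleGraph.edge_adj]
    have := hxy.symm
    grind

/-- Replacing the edge `xz` by the edge `yz`. -/
lemma exists_replace_edge (G : SimpleGraph (Fin n)) {x y z : Fin n} (hxz : G.Adj x z)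
    (hyz : ¬ G.Adj y z) (hne : y ≠ z) :
    ∃ G' : SimpleGraph (Fin n), ∀ S, (x ∈ S ↔ y ∈ S) →
      (∀ w, degIn G' S w + (if w = x ∧ z ∈ S then 1 else 0) =
        degIn G S w + (if w = y ∧ z ∈ S then 1 else 0)) ∧
      ∀ T : Finset (Fin n), (x ∈ T ↔ y ∈ T) →
        ∑ w ∈ T, degIn G' S w = ∑ w ∈ T, degIn G S w := by
  obtain ⟨G₀, hle, h₀⟩ := exists_remove_edge G hxz
  obtain ⟨G', h'⟩ := exists_add_edge G₀ hne fun h => hyz (hle _ _ h)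
  refine ⟨G', fun S hS => ?_⟩
  have key : ∀ w, degIn G' S w + (if w = x ∧ z ∈ S then 1 else 0) =
        degIn G S w + (if w = y ∧ z ∈ S then 1 else 0) := by
    intro w
    rw [h', h₀]
    simp only [hS]
    ring
  refine ⟨key, fun T hT => ?_⟩
  have hsum := sum_congr (rfl : T = T) fun w _ => key w
  have aux : ∀ a : Fin n, ∑ w ∈ T, (if w = a ∧ z ∈ S then 1 else 0) =
      if a ∈ T ∧ z ∈ S then 1 else 0 := by
    intro a
    by_cases hz : z ∈ S <;> simp [hz]
  rw [sum_add_distrib, sum_add_distrib, aux, aux] at hsum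
  simp only [hT] at hsum
  omega

lemma exists_adj_not_adj {G : SimpleGraph (Fin n)} {S : Finset (Fin n)} {x y : Fin n}
    (h : degIn G S y + 2 ≤ degIn G S x) : ∃ z ∈ S, G.Adj x z ∧ ¬ G.Adj y z ∧ y ≠ z := by
  by_contra! hcon
  have hsub : (S.filter fun u => G.Adj x u) ⊆ insert y (S.filter fun u => G.Adj y u) := by
    intro u hu
    rw [mem_filter] at hu
    rw [mem_insert, mem_filter]
    by_cases h1 : G.Adj y u
    · exact Or.inr ⟨hu.1, h1⟩
    · exact Or.inl (hcon u hu.1 hu.2 h1).symm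
  have := (card_le_card hsub).trans (card_insert_le _ _)
  unfold degIn at h
  omega

variable {ι : Type*} [DecidableEq ι] (c : Fin n → ι)

/-- The vertices of color `i`. -/
def block (i : ι) : Finset (Fin n) := univ.filter fun v => c v = i

variable {c}

@[simp] lemma mem_block {i : ι} {v : Fin n} : v ∈ block c i ↔ c v = i := by simp [block]

lemma exists_ge_degIn {H : Finset (Fin n)} (hH : ∀ x y, c x = c y → (x ∈ H ↔ y ∈ H))
    (τ : ι → ℕ) (G : SimpleGraph (Fin n))
    (hG : ∀ i, τ i * (block c i).card ≤ ∑ v ∈ block c i, degIn G H v) :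
    ∃ G' : SimpleGraph (Fin n),
      (∀ i, ∑ v ∈ block c i, degIn G' univ v = ∑ v ∈ block c i, degIn G univ v) ∧
      ∀ v, τ (c v) ≤ degIn G' H v := by
  induction hm : ∑ v, (τ (c v) - degIn G H v) using Nat.strong_induction_on generalizing G with
  | _ m ih =>
  by_cases hall : ∀ v, τ (c v) ≤ degIn G H v
  · exact ⟨G, fun _ => rfl, hall⟩
  push Not at hall
  obtain ⟨x, hx⟩ := hall
  obtain ⟨y, hyx, hy⟩ : ∃ y, c y = c x ∧ τ (c x) < degIn G H y := by
    by_contra! hcon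
    have : ∑ v ∈ block c (c x), degIn G H v < ∑ v ∈ block c (c x), τ (c x) :=
      sum_lt_sum (fun v hv => hcon v (mem_block.1 hv)) ⟨x, mem_block.2 rfl, hx⟩
    rw [sum_const, smul_eq_mul, mul_comm] at this
    exact absurd (hG (c x)) (by omega)
  obtain ⟨z, hzH, hyz, hxz, hne⟩ :=
    exists_adj_not_adj (G := G) (S := H) (x := y) (y := x) (by omega)
  obtain ⟨G', hG'⟩ := exists_replace_edge G hyz hxz hne
  have hb : ∀ i, y ∈ block c i ↔ x ∈ block c i := by simp [hyx]
  obtain ⟨hdeg, hsum⟩ := hG' H (hH _ _ hyx)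
  have hxy : x ≠ y := by rintro rfl; omega
  have hlt : ∑ v, (τ (c v) - degIn G' H v) < m := by
    rw [← hm]
    refine sum_lt_sum (fun w _ => ?_) ⟨x, mem_univ _, ?_⟩
    · have := hdeg w
      by_cases h1 : w = x
      · subst h1; simp [hxy, hzH] at this; omega
      · by_cases h2 : w = y
        · subst h2; simp [h1, hzH] at this; rw [hyx]; omega
        · simp [h1, h2] at this; omega
    · have := hdeg x
      simp [hxy, hzH] at this
      omega
  obtain ⟨G'', h1, h2⟩ := ih _ hlt G' (fun i => by rw [hsum _ (hb i)]; exact hG i) rfl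
  exact ⟨G'', fun i => by rw [h1, (hG' univ (by simp)).2 _ (hb i)], h2⟩

lemma degIn_univ (G : SimpleGraph (Fin n)) (H : Finset (Fin n)) (v : Fin n) :
    degIn G univ v = degIn G H v + degIn G Hᶜ v := by
  unfold degIn
  rw [← card_union_of_disjoint, ← filter_union, union_compl]
  exact disjoint_filter_filter disjoint_compl_right

lemma exists_regular_of_sum {H : Finset (Fin n)} (hH : ∀ x y, c x = c y → (x ∈ H ↔ y ∈ H))
    (τ : ι → ℕ) (k : ℕ) (G : SimpleGraph (Fin n))
    (hk : ∀ i, ∑ v ∈ block c i, degIn G univ v = k * (block c i).card)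
    (hτ : ∀ v, τ (c v) ≤ degIn G H v) :
    ∃ G' : SimpleGraph (Fin n), ∀ v, degIn G' univ v = k ∧ τ (c v) ≤ degIn G' H v := by
  induction hm : ∑ v, ((degIn G univ v - k) + (k - degIn G univ v))
    using Nat.strong_induction_on generalizing G with
  | _ m ih =>
  by_cases hall : ∀ v, degIn G univ v = k
  · exact ⟨G, fun v => ⟨hall v, hτ v⟩⟩
  push Not at hall
  obtain ⟨x, y, hxy, hx, hy⟩ :
      ∃ x y, c x = c y ∧ k < degIn G univ x ∧ degIn G univ y < k := by
    obtain ⟨v, hv⟩ := hall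
    have hs := hk (c v)
    rw [mul_comm, ← smul_eq_mul, ← sum_const] at hs
    rcases lt_or_gt_of_ne hv with h | h
    · by_contra! hcon
      refine absurd hs (sum_lt_sum (fun w hw => ?_) ⟨v, mem_block.2 rfl, h⟩).ne
      by_contra! hw'
      exact absurd (hcon w v (mem_block.1 hw) hw') (by omega)
    · by_contra! hcon
      refine absurd hs (sum_lt_sum (fun w hw => ?_) ⟨v, mem_block.2 rfl, h⟩).ne'
      exact hcon v w (mem_block.1 hw).symm h
  have hxy' : x ≠ y := by rintro rfl; omega
  obtain ⟨z, hxz, hyz, hne, hz⟩ : ∃ z, G.Adj x z ∧ ¬ G.Adj y z ∧ y ≠ z ∧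
      (z ∈ H → τ (c x) < degIn G H x) := by
    by_cases h : τ (c x) < degIn G H x
    · obtain ⟨z, -, h1, h2, h3⟩ :=
        exists_adj_not_adj (G := G) (S := univ) (x := x) (y := y) (by omega)
      exact ⟨z, h1, h2, h3, fun _ => h⟩
    · have e1 := degIn_univ G H x
      have e2 := degIn_univ G H y
      have e3 := hτ y
      rw [← hxy] at e3
      obtain ⟨z, h0, h1, h2, h3⟩ :=
        exists_adj_not_adj (G := G) (S := Hᶜ) (x := x) (y := y) (by omega)
      exact ⟨z, h1, h2, h3, fun h => absurd h (mem_compl.1 h0)⟩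
  obtain ⟨G', hG'⟩ := exists_replace_edge G hxz hyz hne
  obtain ⟨hdegH, -⟩ := hG' H (hH _ _ hxy)
  obtain ⟨hdeg, hsum⟩ := hG' univ (by simp)
  have hlt : ∑ v, ((degIn G' univ v - k) + (k - degIn G' univ v)) < m := by
    rw [← hm]
    refine sum_lt_sum (fun w _ => ?_) ⟨x, mem_univ _, ?_⟩
    · have := hdeg w
      by_cases h1 : w = x
      · subst h1; simp [hxy'] at this; omega
      · by_cases h2 : w = y
        · subst h2; simp [h1] at this; omega
        · simp [h1, h2] at this; omega
    · have := hdeg x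
      simp [hxy'] at this
      omega
  refine ih _ hlt G' (fun i => by rw [hsum _ (by simp [hxy]), hk]) (fun w => ?_) rfl
  have := hdegH w
  have hw := hτ w
  by_cases h1 : w = x
  · subst h1
    by_cases h2 : z ∈ H
    · have := hz h2
      simp [hxy', h2] at *
      omega
    · simp [h2] at this
      omega
  · simp [h1] at this
    omega

/-- Edges between blocks can be chosen freely subject to the obvious capacity bounds. -/
lemma exists_blockCount [Fintype ι] (e : ι → ι → ℕ) (hsymm : ∀ i j, e i j = e j i)
    (heven : ∀ i, Even (e i i))
    (hcap : ∀ i j, e i j ≤ (block c i).card * ((block c j).card - if i = j then 1 else 0)) :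
    ∃ G : SimpleGraph (Fin n), ∀ i j, ∑ v ∈ block c i, degIn G (block c j) v = e i j := by
  suffices ∀ (m : ℕ) (G : SimpleGraph (Fin n)) (s : ι → ι → ℕ),
      (∀ i j, ∑ v ∈ block c i, degIn G (block c j) v = s i j) → (∀ i j, s i j = s j i) →
      (∀ i, Even (s i i)) → (∀ i j, s i j ≤ e i j) → ∑ i, ∑ j, (e i j - s i j) = m →
      ∃ G : SimpleGraph (Fin n), ∀ i j, ∑ v ∈ block c i, degIn G (block c j) v = e i j from
    this _ ⊥ (fun _ _ => 0) (by simp [degIn]) (by simp) (by simp) (by simp) rfl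
  intro m
  induction m using Nat.strong_induction_on with
  | _ m ih =>
  intro G s hs hss hse hsle hm
  by_cases hall : ∀ i j, s i j = e i j
  · exact ⟨G, fun i j => (hs i j).trans (hall i j)⟩
  push Not at hall
  obtain ⟨i, j, hij⟩ := hall
  have hlt := lt_of_le_of_ne (hsle i j) hij
  obtain ⟨x, y, hx, hy, hne, hadj⟩ : ∃ x y, c x = i ∧ c y = j ∧ x ≠ y ∧ ¬ G.Adj x y := by
    by_contra! hcon
    refine absurd (hcap i j) (not_le.2 (lt_of_le_of_lt ?_ hlt))
    rw [← hs, ← smul_eq_mul, ← sum_const]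
    refine sum_le_sum fun v hv => ?_
    rw [mem_block] at hv
    have hsub : (block c j).erase v ⊆ (block c j).filter fun u => G.Adj v u := by
      intro u hu
      rw [mem_erase, mem_block] at hu
      exact mem_filter.2 ⟨mem_block.2 hu.2, hcon v u hv hu.2 hu.1.symm⟩
    refine le_trans ?_ (card_le_card hsub)
    split_ifs with h
    · exact pred_card_le_card_erase
    · rw [erase_eq_of_notMem, Nat.sub_zero]
      rw [mem_block, hv]
      exact h
  obtain ⟨G', hG'⟩ := exists_add_edge G hne hadj
  let s' : ι → ι → ℕ := fun a b => s a b + (if a = i ∧ b = j then 1 else 0) +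
    (if a = j ∧ b = i then 1 else 0)
  have hle : ∀ a b, s' a b ≤ e a b := by
    intro a b
    have h1 := hsle a b
    have h2 := hss i j
    have h3 := hsymm i j
    obtain ⟨p, hp⟩ := hse i
    obtain ⟨q, hq⟩ := heven i
    simp only [s']
    split_ifs with h h' h'
    · obtain ⟨rfl, rfl⟩ := h
      obtain ⟨-, rfl⟩ := h'
      omega
    · obtain ⟨rfl, rfl⟩ := h
      omega
    · obtain ⟨rfl, rfl⟩ := h'
      omega
    · omega
  have hlt' : ∑ a, ∑ b, (e a b - s' a b) < m := by
    rw [← hm]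
    have hle' : ∀ a b, e a b - s' a b ≤ e a b - s a b := fun a b => by simp only [s']; omega
    refine sum_lt_sum (fun a _ => sum_le_sum fun b _ => hle' a b)
      ⟨i, mem_univ _, sum_lt_sum (fun b _ => hle' i b) ⟨j, mem_univ _, ?_⟩⟩
    simp [s']
    omega
  refine ih _ hlt' G' s' (fun a b => ?_) (fun a b => ?_) (fun a => ?_) hle rfl
  · rw [sum_congr rfl fun v _ => hG' _ v, sum_add_distrib, sum_add_distrib, hs]
    have aux : ∀ u w : Fin n, ∑ v ∈ block c a, (if v = u ∧ w ∈ block c b then 1 else 0) =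
        if a = c u ∧ b = c w then 1 else 0 := by
      intro u w
      simp only [mem_block, eq_comm (a := b), eq_comm (a := a)]
      by_cases hw : c w = b <;> simp [hw]
    rw [aux, aux, hx, hy]
  · simp only [s', hss a b, and_comm]
    ring
  · by_cases h : a = i ∧ a = j
    · simpa [s', h.1.symm, h.2.symm, add_assoc] using (hse a).add even_two
    · simpa [s', h, mt And.symm h] using hse a

lemma sum_degIn_block [Fintype ι] (G : SimpleGraph (Fin n)) (v : Fin n) :
    ∑ j, degIn G (block c j) v = degIn G univ v := by
  unfold degIn
  rw [card_eq_sum_card_fiberwise (f := c) (t := univ) (by simp)]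
  refine sum_congr rfl fun j _ => congrArg card ?_
  ext u
  simp [and_comm]

lemma exists_regular [Fintype ι] (e : ι → ι → ℕ) (hsymm : ∀ i j, e i j = e j i)
    (heven : ∀ i, Even (e i i))
    (hcap : ∀ i j, e i j ≤ (block c i).card * ((block c j).card - if i = j then 1 else 0))
    (k : ℕ) (hk : ∀ i, ∑ j, e i j = k * (block c i).card)
    (a : ι) (τ : ι → ℕ) (hτ : ∀ i, τ i * (block c i).card ≤ e i a) :
    ∃ G : SimpleGraph (Fin n), ∀ v, degIn G univ v = k ∧ τ (c v) ≤ degIn G (block c a) v := by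
  have hH : ∀ x y, c x = c y → (x ∈ block c a ↔ y ∈ block c a) := by
    intro x y h
    simp [h]
  obtain ⟨G, hG⟩ := exists_blockCount e hsymm heven hcap
  obtain ⟨G', h1, h2⟩ := exists_ge_degIn hH τ G fun i => by rw [hG]; exact hτ i
  refine exists_regular_of_sum hH τ k G' (fun i => ?_) h2
  rw [h1, ← hk, sum_congr rfl fun v _ => (sum_degIn_block (c := c) G v).symm, sum_comm]
  exact sum_congr rfl fun j _ => hG i j

end Blocks

/-! ### Approving configurations from edge counts -/

section Configurations

variable {n : ℕ}

lemma card_closedNbhd (G : SimpleGraph (Fin n)) (v : Fin n) :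
    (closedNbhd G v).card = degIn G univ v + 1 := by
  have : closedNbhd G v = insert v (univ.filter fun u => G.Adj v u) := by
    ext u
    simp [closedNbhd]
  rw [this, card_insert_of_notMem (by simp)]
  rfl

lemma mem_closedNbhd {G : SimpleGraph (Fin n)} {u v : Fin n} :
    u ∈ closedNbhd G v ↔ u = v ∨ G.Adj v u := by
  simp [closedNbhd]

lemma mem_closedNbhd_comm {G : SimpleGraph (Fin n)} {u v : Fin n} :
    u ∈ closedNbhd G v ↔ v ∈ closedNbhd G u := by
  rw [mem_closedNbhd, mem_closedNbhd, eq_comm, G.adj_comm]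

lemma one_le_sum_iff {f : Fin n → ℤ} (hf : ∀ v, f v = 1 ∨ f v = -1) (S : Finset (Fin n)) :
    1 ≤ ∑ u ∈ S, f u ↔ S.card + 1 ≤ 2 * (S.filter fun u => f u = 1).card := by
  have h1 : ∀ u ∈ S, f u = 2 * (if f u = 1 then 1 else 0) - 1 := by
    intro u _
    rcases hf u with h | h <;> simp [h]
  rw [sum_congr rfl h1, sum_sub_distrib, ← mul_sum, sum_boole, sum_const, nsmul_eq_mul, mul_one]
  omega

/-- Some configuration with parameters `(n, d, h)` is approving. -/
def Approvable (n d h : ℕ) : Prop :=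
  ∃ (G : SimpleGraph (Fin n)) (f : Fin n → ℤ), IsConfig d h G f ∧ IsApproving G f

lemma exists_coloring {h b q : ℕ} (hn : h + b + q = n) :
    ∃ c : Fin n → Fin 3, (block c 0).card = h ∧ (block c 1).card = b ∧ (block c 2).card = q := by
  obtain ⟨H, -, hH⟩ := exists_subset_card_eq (s := (univ : Finset (Fin n))) (n := h)
    (by simp; omega)
  obtain ⟨B, hB', hB⟩ := exists_subset_card_eq (s := Hᶜ) (n := b)
    (by rw [card_compl, Fintype.card_fin]; omega)
  have hdisj : Disjoint H B := disjoint_of_subset_right hB' disjoint_compl_right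
  refine ⟨fun v => if v ∈ H then 0 else if v ∈ B then 1 else 2, ?_, ?_, ?_⟩
  · rw [← hH]
    congr 1
    ext v
    simp only [mem_block]
    split_ifs <;> simp_all
  · rw [← hB]
    congr 1
    ext v
    have : v ∈ H → v ∉ B := fun h => Finset.disjoint_left.1 hdisj h
    simp only [mem_block]
    split_ifs <;> simp_all
  · have : (H ∪ B)ᶜ.card = q := by
      rw [card_compl, card_union_of_disjoint hdisj, Fintype.card_fin]
      omega
    rw [← this]
    congr 1
    ext v
    simp only [mem_block, mem_compl, mem_union]
    split_ifs <;> simp_all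

/-- A block of `h` happy vertices, a block of `b` sad proponents and a block of `q` further sad
vertices, with `hh`, `hb`, … edges inside and between the blocks. If `r = u` then the happy
vertices are proponents as well. -/
lemma approvable_of_counts {u h b q hh hb hq bb bq qq r : ℕ} (hn : h + b + q = n)
    (hhh : 2 * hh ≤ h * (h - 1)) (hhb : hb ≤ h * b) (hhq : hq ≤ h * q)
    (hbb : 2 * bb ≤ b * (b - 1)) (hbq : bq ≤ b * q) (hqq : 2 * qq ≤ q * (q - 1))
    (hdh : 2 * hh + hb + hq = 2 * u * h) (hdb : hb + 2 * bb + bq = 2 * u * b)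
    (hdq : hq + bq + 2 * qq = 2 * u * q) (hr : r * h ≤ 2 * hh) (hu : (u + 1) * b ≤ hb)
    (hmaj : n < 2 * b ∨ (r = u ∧ n < 2 * (h + b))) :
    Approvable n (2 * u + 1) h := by
  obtain ⟨c, hc0, hc1, hc2⟩ := exists_coloring hn
  obtain ⟨G, hG⟩ := exists_regular (c := c)
    ![![2 * hh, hb, hq], ![hb, 2 * bb, bq], ![hq, bq, 2 * qq]]
    (by intro i j; fin_cases i <;> fin_cases j <;> rfl)
    (by intro i; fin_cases i <;> simp)
    (by
      intro i j
      fin_cases i <;> fin_cases j <;> simp [hc0, hc1, hc2] <;> first | assumption | skip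
      all_goals rw [mul_comm]; assumption)
    (2 * u)
    (by intro i; fin_cases i <;> simp [Fin.sum_univ_three, hc0, hc1, hc2] <;> assumption)
    0 ![r, u + 1, 0]
    (by intro i; fin_cases i <;> simp [hc0, hc1, hc2] <;> assumption)
  let f : Fin n → ℤ := fun v => if c v = 0 then 1 else -1
  have hf : ∀ v, f v = 1 ∨ f v = -1 := by
    intro v
    by_cases h : c v = 0 <;> simp [f, h]
  have hf1 : ∀ v, f v = 1 ↔ c v = 0 := by
    intro v
    by_cases h : c v = 0 <;> simp [f, h]
  have hcard : ∀ v, (closedNbhd G v).card = 2 * u + 1 := fun v => by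
    rw [card_closedNbhd, (hG v).1]
  have hprop1 : ∀ v, c v = 1 → 1 ≤ ∑ w ∈ closedNbhd G v, f w := by
    intro v hv
    rw [one_le_sum_iff hf, hcard]
    have h1 := (hG v).2
    rw [hv] at h1
    have h2 : (block c 0).filter (fun w => G.Adj v w) ⊆
        (closedNbhd G v).filter fun w => f w = 1 := by
      intro w
      simp only [mem_filter, mem_block, mem_closedNbhd, hf1]
      tauto
    have h3 := card_le_card h2
    change u + 1 ≤ _ at h1
    unfold degIn at h1
    omega
  have hprop0 : r = u → ∀ v, c v = 0 → 1 ≤ ∑ w ∈ closedNbhd G v, f w := by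
    intro hru v hv
    rw [one_le_sum_iff hf, hcard]
    have h1 := (hG v).2
    rw [hv] at h1
    have h2 : insert v ((block c 0).filter fun w => G.Adj v w) ⊆
        (closedNbhd G v).filter fun w => f w = 1 := by
      intro w
      simp only [mem_insert, mem_filter, mem_block, mem_closedNbhd, hf1]
      rintro (rfl | h)
      · exact ⟨Or.inl rfl, hv⟩
      · tauto
    have h3 := card_le_card h2
    rw [card_insert_of_notMem (by simp)] at h3
    change r ≤ _ at h1
    unfold degIn at h1
    omega
  refine ⟨G, f, ⟨hcard, hf, ?_⟩, ?_⟩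
  · simp only [hf1]
    exact hc0
  · unfold IsApproving numProponents
    rcases hmaj with hmaj | ⟨hru, hmaj⟩
    · have : block c 1 ⊆ univ.filter fun v => 1 ≤ ∑ w ∈ closedNbhd G v, f w := fun v hv =>
        mem_filter.2 ⟨mem_univ _, hprop1 v (mem_block.1 hv)⟩
      have := card_le_card this
      omega
    · have : block c 0 ∪ block c 1 ⊆ univ.filter fun v => 1 ≤ ∑ w ∈ closedNbhd G v, f w := by
        intro v hv
        rw [mem_union, mem_block, mem_block] at hv
        exact mem_filter.2 ⟨mem_univ _, hv.elim (hprop0 hru v) (hprop1 v)⟩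
      have := card_le_card this
      rw [card_union_of_disjoint, hc0, hc1] at this
      · omega
      · exact disjoint_filter.2 fun v _ h0 h1 => by simp [h0] at h1

lemma Approvable.succ {d h : ℕ} (hh : h < n) (ha : Approvable n d h) :
    Approvable n d (h + 1) := by
  obtain ⟨G, f, ⟨hd, hf, hcard⟩, happ⟩ := ha
  obtain ⟨x, hx⟩ : ∃ x, f x ≠ 1 := by
    by_contra! hcon
    simp [hcon] at hcard
    omega
  have hle : ∀ v, f v ≤ Function.update f x 1 v := by
    intro v
    by_cases hv : v = x
    · subst hv
      rcases hf v with h | h <;> simp [h]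
    · simp [hv]
  refine ⟨G, Function.update f x 1, ⟨hd, fun v => ?_, ?_⟩, lt_of_lt_of_le happ ?_⟩
  · by_cases hv : v = x
    · simp [hv]
    · simpa [hv] using hf v
  · have : (univ.filter fun v => Function.update f x 1 v = 1) =
        insert x (univ.filter fun v => f v = 1) := by
      ext v
      by_cases hv : v = x <;> simp [hv]
    rw [this, card_insert_of_notMem (by simpa using hx), hcard]
  · refine Nat.mul_le_mul_left 2 (card_le_card fun v hv => ?_)
    rw [mem_filter] at hv ⊢
    exact ⟨hv.1, hv.2.trans (sum_le_sum fun w _ => hle w)⟩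

lemma Approvable.mono {d h h' : ℕ} (hle : h ≤ h') (hh : h' ≤ n) (ha : Approvable n d h) :
    Approvable n d h' := by
  induction h', hle using Nat.le_induction with
  | base => exact ha
  | succ m _ ih => exact (ih (by omega)).succ (by omega)

/-- Exchanging the opinions exchanges approving and disapproving configurations. -/
lemma exists_disapproving_iff {d h : ℕ} (hn : Odd n) (hd : Odd d) (hh : h ≤ n) :
    (∃ (G : SimpleGraph (Fin n)) (f : Fin n → ℤ), IsConfig d h G f ∧ ¬ IsApproving G f) ↔
      Approvable n d (n - h) := by
  have hconf : ∀ {h : ℕ} {G : SimpleGraph (Fin n)} {f : Fin n → ℤ}, IsConfig d h G f →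
      IsConfig d (n - h) G (-f) := by
    rintro h G f ⟨h1, h2, h3⟩
    refine ⟨h1, fun v => ?_, ?_⟩
    · rcases h2 v with h | h <;> simp [h]
    · have : (univ.filter fun v => (-f) v = 1) = (univ.filter fun v => f v = 1)ᶜ := by
        ext v
        rcases h2 v with h | h <;> simp [h]
      rw [this, card_compl, h3, Fintype.card_fin]
  have hprop : ∀ {h : ℕ} {G : SimpleGraph (Fin n)} {f : Fin n → ℤ}, IsConfig d h G f →
      numProponents G (-f) + numProponents G f = n := by
    rintro h G f ⟨h1, h2, h3⟩
    have : (univ.filter fun v => 1 ≤ ∑ w ∈ closedNbhd G v, (-f) w) =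
        (univ.filter fun v => 1 ≤ ∑ w ∈ closedNbhd G v, f w)ᶜ := by
      ext v
      have hneg : ∀ v, (-f) v = 1 ∨ (-f) v = -1 := fun v => by
        rcases h2 v with h | h <;> simp [h]
      simp only [mem_filter, mem_univ, true_and, mem_compl, one_le_sum_iff h2,
        one_le_sum_iff hneg, h1]
      have hsplit := card_filter_add_card_filter_not (s := closedNbhd G v) (fun w => f w = 1)
      have heq : ((closedNbhd G v).filter fun w => ¬ f w = 1) =
          (closedNbhd G v).filter fun w => (-f) w = 1 := by
        refine filter_congr fun w _ => ?_
        rcases h2 w with h | h <;> simp [h]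
      rw [heq, h1] at hsplit
      obtain ⟨a, rfl⟩ := hd
      omega
    unfold numProponents
    rw [this, card_compl_add_card, Fintype.card_fin]
  obtain ⟨a, ha⟩ := hn
  constructor
  · rintro ⟨G, f, hc, hna⟩
    refine ⟨G, -f, hconf hc, ?_⟩
    have := hprop hc
    unfold IsApproving at *
    omega
  · rintro ⟨G, f, hc, hap⟩
    refine ⟨G, -f, ?_, ?_⟩
    · have := hconf hc
      rwa [Nat.sub_sub_self hh] at this
    · have := hprop hc
      unfold IsApproving at *
      omega

end Configurations

/-! ### Existence of approving configurations -/

section Existence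

variable {n u h N : ℕ}

lemma approvable_of_lt (hN : n + 1 = 2 * N) (hu : 2 * u + 2 ≤ N) {s : ℕ} (hs : s ≤ 2 * u)
    (hhs : (2 * u + 1) * h = (u + 1) * N + s) : Approvable n (2 * u + 1) h := by
  rcases u with _ | w
  · obtain rfl : h = N := by omega
    exact approvable_of_counts (h := h) (b := 0) (q := h - 1) (hh := 0) (hb := 0) (hq := 0)
      (bb := 0) (bq := 0) (qq := 0) (r := 0) (by omega) (by simp) (by simp) (by simp) (by simp)
      (by simp) (by simp) (by simp) (by simp) (by simp) (by simp) (by simp)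
      (Or.inr ⟨rfl, by omega⟩)
  have hhN : h ≤ N := by
    by_contra! hcon
    nlinarith
  obtain ⟨b, rfl⟩ := Nat.exists_eq_add_of_le hhN
  obtain ⟨q, hq⟩ : ∃ q, h + b = q + 1 := ⟨h + b - 1, by omega⟩
  have hE : (w + 1) * h = (w + 2) * b + s := by nlinarith
  have hh3 : w + 3 ≤ h := by
    by_contra! hcon
    nlinarith
  have hb1 : w + 1 ≤ b := by
    by_contra! hcon
    nlinarith
  obtain ⟨p, hh, hp, hps, hhp⟩ : ∃ p hh, p ≤ 1 ∧ p ≤ s ∧ (w + 1) * h + p = 2 * hh := by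
    rcases Nat.even_or_odd' ((w + 1) * h) with ⟨m, hm | hm⟩
    · exact ⟨0, m, by omega, by omega, by omega⟩
    · refine ⟨1, m + 1, le_rfl, ?_, by omega⟩
      by_contra! hs0
      rcases Nat.even_or_odd' w with ⟨a, rfl | rfl⟩
      · have : (2 * a + 2) * b = 2 * ((a + 1) * b) := by ring
        omega
      · have : (2 * a + 1 + 1) * h = 2 * ((a + 1) * h) := by ring
        omega
  obtain ⟨x, bb, hx, hbx⟩ : ∃ x bb, x ≤ 1 ∧ w * b = 2 * bb + x := by
    rcases Nat.even_or_odd' (w * b) with ⟨m, hm | hm⟩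
    · exact ⟨0, m, by omega, by omega⟩
    · exact ⟨1, m, le_rfl, hm⟩
  obtain ⟨s', rfl⟩ := Nat.exists_eq_add_of_le hps
  have hq3 : 2 * w + 3 ≤ q := by omega
  have hqq : s' + x + 2 * ((w + 1) * q + p + b + bb - hh) = 2 * (w + 1) * q := by
    have : s' + x + 2 * (p + b + bb) = 2 * hh := by nlinarith
    have : 2 * w + 3 ≤ (w + 1) * q := by nlinarith
    have e : 2 * (w + 1) * q = 2 * ((w + 1) * q) := by ring
    omega
  refine approvable_of_counts (u := w + 1) (h := h) (b := b) (q := q) (hh := hh)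
    (hb := (w + 2) * b) (hq := s') (bb := bb) (bq := x)
    (qq := (w + 1) * q + p + b + bb - hh) (r := w + 1) (by omega) ?_ ?_ ?_ ?_ ?_ ?_ ?_ ?_ hqq
    (by omega) (by ring_nf; rfl) (Or.inr ⟨rfl, by omega⟩)
  · have : h * (w + 2) ≤ h * (h - 1) := Nat.mul_le_mul_left h (by omega)
    linarith
  · exact Nat.mul_le_mul_right b (by omega)
  · exact (show s' ≤ q by omega).trans (Nat.le_mul_of_pos_left q (by omega))
  · have : b * w ≤ b * (b - 1) := Nat.mul_le_mul_left b (by omega)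
    linarith
  · exact hx.trans (Nat.mul_pos (by omega) (by omega))
  · have : q * (2 * (w + 1)) ≤ q * (q - 1) := Nat.mul_le_mul_left q (by omega)
    linarith
  · linarith
  · linarith

lemma approvable_of_le (hN : n + 1 = 2 * N) (hun : u + 1 ≤ N) (hu : N ≤ 2 * u + 1)
    (hexc : ¬ (N = 2 * u + 1 ∧ (u = 1 ∨ u = 2))) : Approvable n (2 * u + 1) (u + 1) := by
  obtain ⟨b, rfl⟩ := Nat.exists_eq_add_of_le hun
  obtain ⟨c, rfl⟩ := Nat.exists_eq_add_of_le (show b ≤ u by omega)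
  by_cases hb1 : b = 1
  · subst hb1
    obtain ⟨e, rfl⟩ : ∃ e, c = e + 1 := ⟨c - 1, by omega⟩
    obtain ⟨i, hi⟩ : ∃ i, (e + 3) * e = 2 * i := by
      rcases Nat.even_or_odd' e with ⟨a, rfl | rfl⟩
      · exact ⟨(2 * a + 3) * a, by ring⟩
      · exact ⟨(a + 2) * (2 * a + 1), by ring⟩
    refine approvable_of_counts (u := 1 + (e + 1)) (h := 1 + (e + 1) + 1) (b := e + 4) (q := 0)
      (hh := i) (hb := (e + 3) * (e + 4)) (hq := 0) (bb := i + e + 2) (bq := 0) (qq := 0)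
      (r := 0) (by omega) ?_ ?_ (by simp) ?_ (by simp) (by simp) ?_ ?_ (by simp) (by simp) ?_
      (Or.inl (by omega))
    · rw [show 1 + (e + 1) + 1 - 1 = e + 2 by omega]
      nlinarith
    · nlinarith
    · rw [show e + 4 - 1 = e + 3 by omega]
      nlinarith
    · nlinarith
    · nlinarith
    · nlinarith
  by_cases hb2 : b = 2
  · subst hb2
    obtain ⟨e, rfl⟩ : ∃ e, c = e + 1 := ⟨c - 1, by omega⟩
    obtain ⟨i, hi⟩ : ∃ i, (e + 3) * e = 2 * i := by
      rcases Nat.even_or_odd' e with ⟨a, rfl | rfl⟩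
      · exact ⟨(2 * a + 3) * a, by ring⟩
      · exact ⟨(a + 2) * (2 * a + 1), by ring⟩
    refine approvable_of_counts (u := 2 + (e + 1)) (h := 2 + (e + 1) + 1) (b := e + 6) (q := 1)
      (hh := i) (hb := (e + 4) * (e + 6)) (hq := e) (bb := i + 2 * e + 3) (bq := e + 6) (qq := 0)
      (r := 0) (by omega) ?_ ?_ (by omega) ?_ (by omega) (by simp) ?_ ?_ (by omega) (by simp) ?_
      (Or.inl (by omega))
    · rw [show 2 + (e + 1) + 1 - 1 = e + 3 by omega]
      nlinarith
    · nlinarith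
    · rw [show e + 6 - 1 = e + 5 by omega]
      nlinarith
    · nlinarith
    · nlinarith
    · nlinarith
  obtain ⟨i, hi⟩ : ∃ i, (b + c + 1) * (b + c) = 2 * i := by
    rcases Nat.even_or_odd' (b + c) with ⟨a, ha | ha⟩
    · exact ⟨(2 * a + 1) * a, by rw [ha]; ring⟩
    · exact ⟨(a + 1) * (2 * a + 1), by rw [ha]; ring⟩
  rcases Nat.eq_zero_or_pos b with rfl | hpos
  · rw [zero_add] at *
    refine approvable_of_counts (u := c) (h := c + 1) (b := 0) (q := c)
      (hh := i) (hb := 0) (hq := (c + 1) * c) (bb := 0) (bq := 0) (qq := i - c) (r := c)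
      (by omega) ?_ (by simp) le_rfl (by simp) (by simp) ?_ ?_ (by simp) ?_ ?_ (by simp)
      (Or.inr ⟨rfl, by omega⟩)
    · simp [hi]
    · rcases c with _ | c
      · omega
      · rw [Nat.add_sub_cancel, Nat.mul_sub, ← hi, Nat.sub_le_iff_le_add]
        nlinarith
    · nlinarith
    · obtain ⟨j, rfl⟩ := Nat.exists_eq_add_of_le (show c ≤ i by nlinarith)
      rw [Nat.add_sub_cancel_left]
      nlinarith
    · nlinarith
  · obtain ⟨e, rfl⟩ : ∃ e, b = e + 3 := ⟨b - 3, by omega⟩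
    refine approvable_of_counts (u := e + 3 + c) (h := e + 3 + c + 1) (b := e + 3)
      (q := 2 * e + 6 + c) (hh := i) (hb := (e + 3 + c + 1) * (e + 3))
      (hq := (e + 3 + c + 1) * c) (bb := 0) (bq := (e + 3) * (e + 2 + c))
      (qq := i + (e + 3 + c) * (e + 2) + (e + 3)) (r := e + 3 + c)
      (by omega) ?_ le_rfl ?_ (by simp) ?_ ?_ ?_ ?_ ?_ ?_ le_rfl
      (Or.inr ⟨rfl, by omega⟩)
    · simp [hi]
    · exact Nat.mul_le_mul_left _ (by omega)
    · exact Nat.mul_le_mul_left _ (by omega)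
    · rw [show 2 * e + 6 + c - 1 = 2 * e + 5 + c by omega]
      nlinarith
    · nlinarith
    · nlinarith
    · nlinarith
    · nlinarith

lemma approvable_five_three : Approvable 5 3 3 :=
  approvable_of_counts (u := 1) (h := 3) (b := 0) (q := 2) (hh := 2) (hb := 0) (hq := 2)
    (bb := 0) (bq := 0) (qq := 1) (r := 1) (by simp) (by simp) (by simp) (by simp) (by simp)
    (by simp) (by simp) (by simp) (by simp) (by simp) (by simp) (by simp) (by simp)

lemma approvable_nine_five : Approvable 9 5 4 :=
  approvable_of_counts (u := 2) (h := 4) (b := 1) (q := 4) (hh := 5) (hb := 3) (hq := 3)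
    (bb := 0) (bq := 1) (qq := 6) (r := 2) (by simp) (by simp) (by simp) (by simp) (by simp)
    (by simp) (by simp) (by simp) (by simp) (by simp) (by simp) (by simp) (by simp)

lemma approvable_of_bounds (hN : n + 1 = 2 * N) (hun : u + 1 ≤ N)
    (hexc : ¬ (N = 2 * u + 1 ∧ (u = 1 ∨ u = 2))) (h1 : (u + 1) * N ≤ (2 * u + 1) * h)
    (h2 : u + 1 ≤ h) (hh : h ≤ n) : Approvable n (2 * u + 1) h := by
  rcases le_or_gt N (2 * u + 1) with hle | hlt
  · exact (approvable_of_le hN hun hle hexc).mono h2 hh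
  · let k := ((u + 1) * N + 2 * u) / (2 * u + 1)
    have hdiv : (2 * u + 1) * k + ((u + 1) * N + 2 * u) % (2 * u + 1) = (u + 1) * N + 2 * u :=
      Nat.div_add_mod _ _
    have hmod := Nat.mod_lt ((u + 1) * N + 2 * u) (show 0 < 2 * u + 1 by omega)
    have hk : k ≤ h := by
      refine Nat.le_of_lt_succ ((Nat.div_lt_iff_lt_mul (by omega)).2 ?_)
      nlinarith
    exact (approvable_of_lt hN (by omega) (h := k)
      (s := 2 * u - ((u + 1) * N + 2 * u) % (2 * u + 1)) (by omega) (by omega)).mono hk hh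

end Existence

/-! ### Necessary conditions -/

section Necessity

variable {n u h N : ℕ}

lemma sum_card_filter_closedNbhd (G : SimpleGraph (Fin n)) (S T : Finset (Fin n)) :
    ∑ v ∈ S, (T.filter fun w => w ∈ closedNbhd G v).card =
      ∑ v ∈ T, (S.filter fun w => w ∈ closedNbhd G v).card := by
  have := sum_card_bipartiteAbove_eq_sum_card_bipartiteBelow (s := S) (t := T)
    (fun v w => w ∈ closedNbhd G v)
  unfold bipartiteAbove bipartiteBelow at this
  rw [this]
  simp only [mem_closedNbhd_comm]

lemma Approvable.bounds (hN : n + 1 = 2 * N) (ha : Approvable n (2 * u + 1) h) :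
    (u + 1) * N ≤ (2 * u + 1) * h ∧ u + 1 ≤ h ∧
      ¬ (h = u + 1 ∧ N = 2 * u + 1 ∧ (u = 1 ∨ u = 2)) := by
  obtain ⟨G, f, ⟨hd, hf, hcard⟩, happ⟩ := ha
  unfold IsApproving numProponents at happ
  set P := univ.filter fun v => 1 ≤ ∑ w ∈ closedNbhd G v, f w with hP
  set H := univ.filter fun v => f v = 1 with hH
  have hPN : N ≤ P.card := by omega
  have hPH : ∀ v ∈ P, u + 1 ≤ (H.filter fun w => w ∈ closedNbhd G v).card := by
    intro v hv
    have h1 := (mem_filter.1 hv).2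
    rw [one_le_sum_iff hf, hd] at h1
    have : (H.filter fun w => w ∈ closedNbhd G v) =
        (closedNbhd G v).filter fun w => f w = 1 := by
      ext w
      simp [hH, and_comm]
    rw [this]
    omega
  have hsub : ∀ (S : Finset (Fin n)) v, (S.filter fun w => w ∈ closedNbhd G v) ⊆
      closedNbhd G v := fun S v w hw => (mem_filter.1 hw).2
  have hle : ∀ (S : Finset (Fin n)) v, (S.filter fun w => w ∈ closedNbhd G v).card ≤
      2 * u + 1 := fun S v => hd v ▸ card_le_card (hsub S v)
  refine ⟨?_, ?_, ?_⟩
  · calc (u + 1) * N ≤ (u + 1) * P.card := Nat.mul_le_mul_left _ hPN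
      _ = ∑ v ∈ P, (u + 1) := by rw [sum_const, smul_eq_mul, mul_comm]
      _ ≤ _ := sum_le_sum hPH
      _ = _ := sum_card_filter_closedNbhd G P H
      _ ≤ ∑ v ∈ H, (2 * u + 1) := sum_le_sum fun v _ => hle P v
      _ = (2 * u + 1) * h := by rw [sum_const, smul_eq_mul, mul_comm, hcard]
  · obtain ⟨v, hv⟩ : P.Nonempty := card_pos.1 (by omega)
    exact (hPH v hv).trans ((card_filter_le _ _).trans hcard.le)
  · rintro ⟨rfl, rfl, hu⟩
    have hall : ∀ v ∈ P, H ⊆ closedNbhd G v := by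
      intro v hv
      have := eq_of_subset_of_card_le (filter_subset _ _) (hcard.le.trans (hPH v hv))
      rw [← this]
      exact hsub H v
    have hnb : ∀ w ∈ H, P = closedNbhd G w := by
      intro w hw
      refine eq_of_subset_of_card_le (fun v hv => mem_closedNbhd_comm.1 (hall v hv hw)) ?_
      rw [hd]
      exact hPN
    have hHP : H ⊆ P := by
      intro w hw
      rw [hnb w hw, mem_closedNbhd]
      exact Or.inl rfl
    obtain ⟨w₀, hw₀⟩ : H.Nonempty := card_pos.1 (by omega)
    have hPcard : P.card = 2 * u + 1 := by rw [hnb w₀ hw₀, hd]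
    have hPc : Pᶜ.card = 2 * u := by
      rw [card_compl, Fintype.card_fin]
      omega
    have hPHcard : (P \ H).card = u := by
      rw [card_sdiff_of_subset hHP]
      omega
    have h1 : ∀ v ∈ Pᶜ, 1 ≤ ((P \ H).filter fun w => w ∈ closedNbhd G v).card := by
      intro v hv
      rw [Nat.succ_le_iff, card_pos]
      by_contra hempty
      rw [not_nonempty_iff_eq_empty, filter_eq_empty_iff] at hempty
      have : closedNbhd G v ⊆ Pᶜ := by
        intro w hw
        rw [mem_compl]
        intro hwP
        refine hempty (mem_sdiff.2 ⟨hwP, fun hwH => ?_⟩) hw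
        rw [mem_closedNbhd_comm, ← hnb w hwH] at hw
        exact mem_compl.1 hv hw
      have := card_le_card this
      rw [hd] at this
      omega
    have h2 : ∀ v ∈ P \ H, (Pᶜ.filter fun w => w ∈ closedNbhd G v).card ≤ u - 1 := by
      intro v hv
      rw [mem_sdiff] at hv
      have hsub' : insert v H ∪ (Pᶜ.filter fun w => w ∈ closedNbhd G v) ⊆ closedNbhd G v := by
        refine union_subset (insert_subset (mem_closedNbhd.2 (Or.inl rfl)) (hall v hv.1)) ?_
        exact hsub _ v
      have := card_le_card hsub'
      rw [card_union_of_disjoint, card_insert_of_notMem hv.2, hd, hcard] at this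
      · omega
      · refine disjoint_of_subset_right (filter_subset _ _) ?_
        exact disjoint_of_subset_left (insert_subset hv.1 hHP) disjoint_compl_right
    have hsum := sum_card_filter_closedNbhd G Pᶜ (P \ H)
    have h3 := sum_le_sum h1
    have h4 := sum_le_sum h2
    rw [sum_const, hPc, smul_eq_mul] at h3
    rw [sum_const, hPHcard, smul_eq_mul] at h4
    rcases hu with rfl | rfl <;> omega

end Necessity

lemma ceil_le_natCast_iff (u N h : ℕ) :
    ⌈((u : ℚ) + 1) * max ((N : ℚ) / (2 * u + 1)) 1⌉ ≤ (h : ℤ) ↔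
      (u + 1) * N ≤ (2 * u + 1) * h ∧ u + 1 ≤ h := by
  rw [Int.ceil_le, mul_max_of_nonneg _ _ (by positivity), max_le_iff, mul_one, ← mul_div_assoc,
    div_le_iff₀ (by positivity), mul_comm (((h : ℤ) : ℚ))]
  norm_cast

lemma approvable_iff {n u h N : ℕ} (hN : n + 1 = 2 * N) (hun : u + 1 ≤ N) (hh : h ≤ n) :
    Approvable n (2 * u + 1) h ↔
      ⌈((u : ℚ) + 1) * max ((N : ℚ) / (2 * u + 1)) 1⌉ +
        (if (n = 5 ∧ 2 * u + 1 = 3) ∨ (n = 9 ∧ 2 * u + 1 = 5) then 1 else 0) ≤ (h : ℤ) := by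
  split_ifs with hexc
  · rw [← le_sub_iff_add_le]
    constructor
    · intro ha
      obtain ⟨h1, h2, h3⟩ := ha.bounds hN
      have := (ceil_le_natCast_iff u N (h - 1)).2 (by
        rcases hexc with ⟨rfl, hu⟩ | ⟨rfl, hu⟩
        · obtain rfl : u = 1 := by omega
          omega
        · obtain rfl : u = 2 := by omega
          omega)
      rwa [Nat.cast_sub (by omega), Nat.cast_one] at this
    · intro hle
      have hpos : (0 : ℤ) ≤ (h : ℤ) - 1 := by
        refine le_trans (Int.ceil_nonneg ?_) hle
        positivity
      have := (ceil_le_natCast_iff u N (h - 1)).1 (by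
        rwa [Nat.cast_sub (by omega), Nat.cast_one])
      rcases hexc with ⟨rfl, hu⟩ | ⟨rfl, hu⟩
      · rw [hu]
        exact approvable_five_three.mono (by omega) hh
      · rw [hu]
        exact approvable_nine_five.mono (by omega) hh
  · rw [add_zero, ceil_le_natCast_iff]
    refine ⟨fun ha => ⟨(ha.bounds hN).1, (ha.bounds hN).2.1⟩, fun h => ?_⟩
    exact approvable_of_bounds hN hun (by omega) h.1 h.2 hh

/-- the trichotomy of configuration classes: uniformly disapproving iff
`h < M`, mixed iff `M ≤ h ≤ n - M`, uniformly approving iff `h > n - M`, where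
`M = ⌈((d+1)/2)·max{(n+1)/(2d),1}⌉ + [(n,d) ∈ {(5,3),(9,5)}]`. -/
theorem stmt14 (n d : ℕ) (hn : Odd n) (hd : Odd d) (hnpos : 0 < n) (hdpos : 0 < d)
    (hdn : d ≤ n) (M : ℤ)
    (hM : M = ⌈((d : ℚ) + 1) / 2 * max (((n : ℚ) + 1) / (2 * (d : ℚ))) 1⌉ +
      (if (n = 5 ∧ d = 3) ∨ (n = 9 ∧ d = 5) then 1 else 0)) :
    ∀ h : ℕ, h ≤ n →
      ((∀ (G : SimpleGraph (Fin n)) (f : Fin n → ℤ),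
          IsConfig d h G f → ¬ IsApproving G f) ↔ (h : ℤ) < M) ∧
      (((∃ (G : SimpleGraph (Fin n)) (f : Fin n → ℤ), IsConfig d h G f ∧ IsApproving G f) ∧
        (∃ (G : SimpleGraph (Fin n)) (f : Fin n → ℤ), IsConfig d h G f ∧ ¬ IsApproving G f)) ↔
        (M ≤ (h : ℤ) ∧ (h : ℤ) ≤ (n : ℤ) - M)) ∧
      ((∀ (G : SimpleGraph (Fin n)) (f : Fin n → ℤ),
          IsConfig d h G f → IsApproving G f) ↔ (h : ℤ) > (n : ℤ) - M) := by
  obtain ⟨N, hN⟩ : ∃ N, n + 1 = 2 * N := by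
    obtain ⟨a, rfl⟩ := hn
    exact ⟨a + 1, by ring⟩
  obtain ⟨u, rfl⟩ := id hd
  have hM' : M = ⌈((u : ℚ) + 1) * max ((N : ℚ) / (2 * u + 1)) 1⌉ +
      (if (n = 5 ∧ 2 * u + 1 = 3) ∨ (n = 9 ∧ 2 * u + 1 = 5) then 1 else 0) := by
    have hN' : (n : ℚ) + 1 = 2 * N := by exact_mod_cast hN
    rw [hM, hN', mul_div_mul_left _ _ two_ne_zero]
    push_cast
    rw [show (2 * (u : ℚ) + 1 + 1) / 2 = u + 1 by ring]
  have key : ∀ h : ℕ, h ≤ n → (Approvable n (2 * u + 1) h ↔ M ≤ h) := fun h hh => by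
    rw [hM']
    exact approvable_iff hN (by omega) hh
  intro h hh
  have happ : (∃ (G : SimpleGraph (Fin n)) (f : Fin n → ℤ),
      IsConfig (2 * u + 1) h G f ∧ IsApproving G f) ↔ M ≤ h := key h hh
  have hdis : (∃ (G : SimpleGraph (Fin n)) (f : Fin n → ℤ),
      IsConfig (2 * u + 1) h G f ∧ ¬ IsApproving G f) ↔ (h : ℤ) ≤ n - M := by
    rw [exists_disapproving_iff hn hd hh, key _ (Nat.sub_le n h), Nat.cast_sub hh, le_sub_comm]
  refine ⟨?_, and_congr happ hdis, ?_⟩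
  · rw [← not_le, ← happ]
    push Not
    rfl
  · rw [gt_iff_lt, ← not_le, ← hdis]
    push Not
    rfl
end

section
/- Let n be an odd positive integer with n ≡ 7 (mod 8). Then hmin(n) = (n+5)/4, and for every odd d with 1 ≤ d ≤ n: hmin(n, d) = hmin(n) if and only if (n+5)/4 ≤ d ≤ (n+3)/2. -/
open Finset
open scoped Classical

/-- A reflexive symmetric system of neighborhoods on any type with `n` elements yields a
configuration on `Fin n`; the number `h` of happy vertices is read off from the opinion sum. -/
lemma exists_approving_config {V : Type*} [Fintype V] {n d h : ℕ} (hV : Fintype.card V = n)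
    (N : V → Finset V) (hrefl : ∀ v, v ∈ N v) (hsymm : ∀ u v, u ∈ N v → v ∈ N u)
    (hcard : ∀ v, (N v).card = d) (f : V → ℤ) (hf : ∀ v, f v = 1 ∨ f v = -1)
    (hsum : ∑ v, f v = 2 * h - n) (P : Finset V) (hP : ∀ v ∈ P, 1 ≤ ∑ u ∈ N v, f u)
    (hPcard : n < 2 * P.card) :
    ∃ (G : SimpleGraph (Fin n)) (f : Fin n → ℤ), IsConfig d h G f ∧ IsApproving G f := by
  let e : V ≃ Fin n := Fintype.equivFinOfCardEq hV
  let G : SimpleGraph (Fin n) :=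
    { Adj := fun u v => u ≠ v ∧ e.symm u ∈ N (e.symm v)
      symm := ⟨fun u v huv => ⟨huv.1.symm, hsymm _ _ huv.2⟩⟩
      loopless := ⟨fun _ hu => hu.1 rfl⟩ }
  have hN : ∀ v, closedNbhd G (e v) = (N v).map e.toEmbedding := by
    intro v
    ext u
    obtain ⟨u, rfl⟩ := e.surjective u
    simp only [closedNbhd, G, mem_filter, mem_univ, true_and, mem_map_equiv,
      Equiv.symm_apply_apply, e.injective.eq_iff, ne_eq]
    constructor
    · rintro (rfl | ⟨-, huv⟩)
      · exact hrefl _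
      · exact hsymm _ _ huv
    · intro huv
      by_cases h : u = v
      · exact Or.inl h
      · exact Or.inr ⟨fun h' => h h'.symm, hsymm _ _ huv⟩
  refine ⟨G, f ∘ e.symm, ⟨fun v => ?_, fun v => hf _, ?_⟩, ?_⟩
  · obtain ⟨v, rfl⟩ := e.surjective v
    rw [hN, card_map, hcard]
  · have hind : ∀ v, f v = 2 * (if f v = 1 then 1 else 0) - 1 := by
      intro v
      rcases hf v with h | h <;> simp [h]
    have hcount : (univ.filter fun v => (f ∘ e.symm) v = 1).card =
        (univ.filter fun v => f v = 1).card := by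
      rw [← card_map e.toEmbedding]
      congr 1
      ext v
      simp
    rw [hcount]
    have : ∑ v, f v = 2 * ((univ.filter fun v => f v = 1).card : ℤ) - n := by
      rw [sum_congr rfl fun v _ => hind v, sum_sub_distrib, ← mul_sum, sum_boole]
      simp [hV]
    omega
  · have hle : P.card ≤ numProponents G (f ∘ e.symm) := by
      rw [numProponents, ← card_map e.toEmbedding]
      refine card_le_card fun u hu => ?_
      obtain ⟨v, hv, rfl⟩ := mem_map.1 hu
      simpa [hN] using hP v hv
    unfold IsApproving
    omega

/-- The cyclic interval of radius `r` around `v`. -/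
def cyclicInterval {k : ℕ} (r : ℕ) (v : ZMod k) : Finset (ZMod k) :=
  (range (2 * r + 1)).image fun i : ℕ => v - r + i

lemma mem_cyclicInterval_self {k : ℕ} (r : ℕ) (v : ZMod k) : v ∈ cyclicInterval r v :=
  mem_image.2 ⟨r, mem_range.2 (by omega), by ring⟩

lemma mem_cyclicInterval_symm {k r : ℕ} {u v : ZMod k} (h : u ∈ cyclicInterval r v) :
    v ∈ cyclicInterval r u := by
  obtain ⟨i, hi, rfl⟩ := mem_image.1 h
  have hi' : i ≤ 2 * r := by simpa [Nat.lt_succ_iff] using hi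
  refine mem_image.2 ⟨2 * r - i, mem_range.2 (by omega), ?_⟩
  push_cast [hi']
  ring

lemma cyclicInterval_injOn {k r : ℕ} (hk : 2 * r + 1 ≤ k) (v : ZMod k) :
    Set.InjOn (fun i : ℕ => v - r + i) (range (2 * r + 1) : Set ℕ) := by
  intro i hi j hj hij
  simp only [coe_range, Set.mem_Iio] at hi hj
  have h := (ZMod.natCast_eq_natCast_iff' i j k).1 (add_left_cancel hij)
  rwa [Nat.mod_eq_of_lt (by omega), Nat.mod_eq_of_lt (by omega)] at h

lemma card_cyclicInterval {k r : ℕ} (hk : 2 * r + 1 ≤ k) (v : ZMod k) :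
    (cyclicInterval r v).card = 2 * r + 1 := by
  rw [cyclicInterval, card_image_of_injOn (cyclicInterval_injOn hk v), card_range]

/-- If `F` has increments `g (x mod k)` on `[0, 2k)`, sums of `g` over cyclic intervals are
differences of `F`. -/
lemma sum_cyclicInterval {k r : ℕ} [NeZero k] (hk : 2 * r + 1 ≤ k) (v : ZMod k) (g F : ℕ → ℤ)
    (hF : ∀ x < 2 * k, F (x + 1) - F x = g (x % k)) :
    ∃ a < k, ∑ u ∈ cyclicInterval r v, g u.val = F (a + (2 * r + 1)) - F a := by
  refine ⟨(v - r : ZMod k).val, ZMod.val_lt _, ?_⟩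
  have hlt := ZMod.val_lt (v - r : ZMod k)
  have hval : ∀ i : ℕ, (v - r + i : ZMod k).val = ((v - r : ZMod k).val + i) % k := by
    intro i
    rw [← ZMod.val_natCast, Nat.cast_add, ZMod.natCast_zmod_val]
  rw [cyclicInterval, sum_image (cyclicInterval_injOn hk v)]
  simp only [hval]
  generalize (v - r : ZMod k).val = a at hlt
  refine Eq.trans ?_ (sum_range_sub (fun i => F (a + i)) (2 * r + 1))
  exact sum_congr rfl fun i hi => (hF _ (by have := mem_range.1 hi; omega)).symm

lemma sum_zmod_val {k : ℕ} [NeZero k] (g : ℕ → ℤ) :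
    ∑ u : ZMod k, g u.val = ∑ i ∈ range k, g i :=
  sum_nbij ZMod.val (fun u _ => mem_range.2 (ZMod.val_lt u))
    (fun _ _ _ _ h => ZMod.val_injective k h)
    (fun i hi => ⟨i, by simp, ZMod.val_cast_of_lt (by simpa using hi)⟩) fun _ _ => rfl

/-- Opinions around a cycle of length `4 * M`: they alternate, except that the happy vertices
`4 * M - 1, 0` and `2 * M - 2, 2 * M - 1` are consecutive. -/
def cycleOpinion (M x : ℕ) : ℤ :=
  if x + 1 < 2 * M then (if x % 2 = 0 then 1 else -1) else (if x % 2 = 0 then -1 else 1)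

/-- Partial sums of `cycleOpinion`, continued periodically for two turns around the cycle. -/
def cycleOpinionSum (M x : ℕ) : ℤ :=
  if x < 2 * M then (x % 2 : ℕ) else if x < 4 * M then 1 + ((x + 1) % 2 : ℕ)
  else if x < 6 * M then 2 + (x % 2 : ℕ) else 3 + ((x + 1) % 2 : ℕ)

lemma cycleOpinion_eq_or (M x : ℕ) : cycleOpinion M x = 1 ∨ cycleOpinion M x = -1 := by
  unfold cycleOpinion
  split_ifs <;> simp

lemma cycleOpinionSum_succ_sub {M x : ℕ} (hx : x < 2 * (4 * M)) :
    cycleOpinionSum M (x + 1) - cycleOpinionSum M x = cycleOpinion M (x % (4 * M)) := by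
  have hmod : x % (4 * M) = if x < 4 * M then x else x - 4 * M := by
    split_ifs with h
    · exact Nat.mod_eq_of_lt h
    · rw [Nat.mod_eq_sub_mod (by omega), Nat.mod_eq_of_lt (by omega)]
  rw [hmod]
  unfold cycleOpinion cycleOpinionSum
  split_ifs <;> omega

lemma one_le_cycleOpinionSum_sub {M r a : ℕ} (hr : M ≤ r) (ha : a < 4 * M) :
    1 ≤ cycleOpinionSum M (a + (2 * r + 1)) - cycleOpinionSum M a := by
  unfold cycleOpinionSum
  split_ifs <;> omega

lemma sum_cycleOpinion {M : ℕ} (hM : 1 ≤ M) : ∑ i ∈ range (4 * M), cycleOpinion M i = 2 := by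
  have h : ∀ i ∈ range (4 * M),
      cycleOpinion M i = cycleOpinionSum M (i + 1) - cycleOpinionSum M i := by
    intro i hi
    have := mem_range.1 hi
    rw [cycleOpinionSum_succ_sub (by omega), Nat.mod_eq_of_lt this]
  rw [sum_congr rfl h, sum_range_sub (cycleOpinionSum M)]
  unfold cycleOpinionSum
  split_ifs <;> omega

/-- Two disjoint circulant graphs, on `4 * M` and `4 * M - 1` vertices. -/
lemma exists_config_of_lt {M r : ℕ} (hM : 1 ≤ M) (hr : M ≤ r) (hr' : r < 2 * M) :
    ∃ (G : SimpleGraph (Fin (8 * M - 1))) (f : Fin (8 * M - 1) → ℤ),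
      IsConfig (2 * r + 1) (2 * M + 1) G f ∧ IsApproving G f := by
  have : NeZero (4 * M) := ⟨by omega⟩
  have : NeZero (4 * M - 1) := ⟨by omega⟩
  refine exists_approving_config (V := ZMod (4 * M) ⊕ ZMod (4 * M - 1)) ?_
    (Sum.elim (fun v => (cyclicInterval r v).disjSum ∅) fun v => disjSum ∅ (cyclicInterval r v))
    ?_ ?_ ?_ (Sum.elim (fun v => cycleOpinion M v.val) fun _ => -1) ?_ ?_ (disjSum univ ∅) ?_ ?_
  · simp only [Fintype.card_sum, ZMod.card]
    omega
  · rintro (v | v) <;> simp [mem_cyclicInterval_self]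
  · rintro (u | u) (v | v) <;> simp <;> exact mem_cyclicInterval_symm
  · rintro (v | v) <;> simp <;> exact card_cyclicInterval (by omega) v
  · rintro (v | v)
    · exact cycleOpinion_eq_or _ _
    · exact Or.inr rfl
  · rw [Fintype.sum_sum_type]
    simp only [Sum.elim_inl, Sum.elim_inr]
    rw [sum_zmod_val (cycleOpinion M), sum_cycleOpinion hM]
    simp only [sum_const, card_univ, ZMod.card, nsmul_eq_mul]
    push_cast
    omega
  · rintro (v | v) hv
    · obtain ⟨a, ha, h⟩ := sum_cyclicInterval (k := 4 * M) (r := r) (by omega) v (cycleOpinion M)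
        (cycleOpinionSum M) fun x hx => cycleOpinionSum_succ_sub hx
      simp only [Sum.elim_inl, sum_disjSum, sum_empty, add_zero, h]
      exact one_le_cycleOpinionSum_sub hr ha
    · simp at hv
  · simp only [card_disjSum, card_univ, ZMod.card, card_empty]
    omega

lemma sum_ite_lt {k h : ℕ} (hk : h ≤ k) :
    ∑ j : Fin k, (if (j : ℕ) < h then (1 : ℤ) else -1) = 2 * h - k := by
  rw [Fin.sum_univ_eq_sum_range (fun j => if j < h then (1 : ℤ) else -1) k,
    ← sum_range_add_sum_Ico _ hk, sum_congr rfl fun j hj => if_pos (mem_range.1 hj),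
    sum_congr rfl fun j hj => if_neg (not_lt.2 (mem_Ico.1 hj).1)]
  simp [hk]
  ring

/-- The complete bipartite graph on `4 * M` and `4 * M - 1` vertices, with a perfect matching
added on the larger side. -/
lemma exists_config_of_eq {M : ℕ} (hM : 1 ≤ M) :
    ∃ (G : SimpleGraph (Fin (8 * M - 1))) (f : Fin (8 * M - 1) → ℤ),
      IsConfig (4 * M + 1) (2 * M + 1) G f ∧ IsApproving G f := by
  refine exists_approving_config (V := (Fin (2 * M) × Bool) ⊕ Fin (4 * M - 1)) ?_
    (Sum.elim (fun v => disjSum ({v.1} ×ˢ univ) univ) fun v => disjSum univ {v})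
    ?_ ?_ ?_ (Sum.elim (fun _ => -1) fun j => if (j : ℕ) < 2 * M + 1 then 1 else -1) ?_ ?_
    (disjSum univ ∅) ?_ ?_
  · simp
    omega
  · rintro (v | v) <;> simp [-Fintype.univ_bool]
  · rintro (u | u) (v | v) <;> simp [-Fintype.univ_bool, -singleton_product, eq_comm]
  · rintro (v | v) <;> simp <;> omega
  · rintro (v | v)
    · exact Or.inr rfl
    · simp only [Sum.elim_inr]
      split_ifs <;> simp
  · rw [Fintype.sum_sum_type]
    simp only [Sum.elim_inl, Sum.elim_inr]
    rw [sum_ite_lt (by omega)]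
    simp
    omega
  · rintro (v | v) hv
    · simp only [Sum.elim_inl, sum_disjSum, Sum.elim_inr]
      rw [sum_ite_lt (by omega)]
      simp
      omega
    · simp at hv
  · simp
    omega

lemma exists_config_all_happy {n r : ℕ} (hr : 2 * r + 1 ≤ n) :
    ∃ (G : SimpleGraph (Fin n)) (f : Fin n → ℤ),
      IsConfig (2 * r + 1) n G f ∧ IsApproving G f := by
  have : NeZero n := ⟨by omega⟩
  refine exists_approving_config (V := ZMod n) (ZMod.card n) (cyclicInterval r)
    (mem_cyclicInterval_self r) (fun _ _ => mem_cyclicInterval_symm)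
    (card_cyclicInterval hr) (fun _ => 1) (fun _ => Or.inl rfl) ?_ univ (fun v _ => ?_) ?_
  · simp
    ring
  · simp [card_cyclicInterval hr]
  · simp
    omega

section LowerBounds

variable {n d h : ℕ} {G : SimpleGraph (Fin n)} {f : Fin n → ℤ}

lemma sum_closedNbhd_eq (hc : IsConfig d h G f) (v : Fin n) :
    ∑ u ∈ closedNbhd G v, f u = 2 * (((closedNbhd G v).filter fun u => f u = 1).card : ℤ) - d := by
  have hind : ∀ v, f v = 2 * (if f v = 1 then 1 else 0) - 1 := by
    intro v
    rcases hc.2.1 v with h | h <;> simp [h]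
  rw [sum_congr rfl fun u _ => hind u, sum_sub_distrib, ← mul_sum, sum_boole]
  simp [hc.1 v]

lemma sum_card_happy_closedNbhd (hc : IsConfig d h G f) :
    ∑ v, ((closedNbhd G v).filter fun u => f u = 1).card = h * d := by
  have hswap := sum_card_bipartiteAbove_eq_sum_card_bipartiteBelow
    (s := univ) (t := univ.filter fun u => f u = 1) fun v u => u ∈ closedNbhd G v
  calc ∑ v, ((closedNbhd G v).filter fun u => f u = 1).card
      = ∑ v, (bipartiteAbove (fun v u => u ∈ closedNbhd G v)
          (univ.filter fun u => f u = 1) v).card := by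
        refine sum_congr rfl fun v _ => congrArg card ?_
        ext u
        simp [bipartiteAbove, and_comm]
    _ = ∑ u ∈ univ.filter (fun u => f u = 1), d := by
        rw [hswap]
        refine sum_congr rfl fun u _ => ?_
        rw [← hc.1 u]
        congr 1
        ext v
        simp [bipartiteBelow, closedNbhd, G.adj_comm, eq_comm]
    _ = h * d := by rw [sum_const, hc.2.2, smul_eq_mul]

lemma numProponents_mul_le (hc : IsConfig d h G f) :
    numProponents G f * (d + 1) ≤ 2 * (h * d) := by
  rw [← sum_card_happy_closedNbhd hc, mul_sum, numProponents, ← smul_eq_mul]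
  refine (card_nsmul_le_sum _ _ _ fun v hv => ?_).trans
    (sum_le_sum_of_subset (filter_subset _ _))
  have := (mem_filter.1 hv).2
  rw [sum_closedNbhd_eq hc] at this
  omega

lemma degree_succ_le_two_mul (hc : IsConfig d h G f) (ha : IsApproving G f) : d + 1 ≤ 2 * h := by
  have hpos : 0 < numProponents G f := by
    unfold IsApproving at ha
    omega
  obtain ⟨v, hv⟩ := card_pos.1 hpos
  have hsum := (mem_filter.1 hv).2
  rw [sum_closedNbhd_eq hc] at hsum
  have hle : ((closedNbhd G v).filter fun u => f u = 1).card ≤ h :=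
    hc.2.2 ▸ card_le_card (filter_subset_filter _ (subset_univ _))
  omega

end LowerBounds

lemma four_mul_mul_succ_le {M d h : ℕ} {G : SimpleGraph (Fin (8 * M - 1))}
    {f : Fin (8 * M - 1) → ℤ} (hc : IsConfig d h G f) (ha : IsApproving G f) :
    2 * M * (d + 1) ≤ h * d := by
  have hp : 4 * M ≤ numProponents G f := by
    unfold IsApproving at ha
    omega
  nlinarith [numProponents_mul_le hc, Nat.mul_le_mul_right (d + 1) hp]

lemma exists_config_hmin {n d : ℕ} (hd : Odd d) (hdn : d ≤ n) :
    ∃ (G : SimpleGraph (Fin n)) (f : Fin n → ℤ), IsConfig d (hmin n d) G f ∧ IsApproving G f := by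
  obtain ⟨r, rfl⟩ := hd
  exact Nat.sInf_mem (s := {h : ℕ | ∃ (G : SimpleGraph (Fin n)) (f : Fin n → ℤ),
    IsConfig (2 * r + 1) h G f ∧ IsApproving G f}) ⟨n, exists_config_all_happy hdn⟩

lemma lt_hmin {M d : ℕ} (hd : Odd d) (hdn : d ≤ 8 * M - 1) (hM : 1 ≤ M) :
    2 * M < hmin (8 * M - 1) d := by
  obtain ⟨G, f, hc, ha⟩ := exists_config_hmin hd hdn
  have h := four_mul_mul_succ_le hc ha
  by_contra! hle
  nlinarith [Nat.mul_le_mul_right d hle]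

lemma hmin_eq_iff {M d : ℕ} (hM : 1 ≤ M) (hd : Odd d) (hdn : d ≤ 8 * M - 1) :
    hmin (8 * M - 1) d = 2 * M + 1 ↔ 2 * M + 1 ≤ d ∧ d ≤ 4 * M + 1 := by
  constructor
  · intro h
    obtain ⟨G, f, hc, ha⟩ := exists_config_hmin hd hdn
    rw [h] at hc
    have h₁ := four_mul_mul_succ_le hc ha
    have h₂ := degree_succ_le_two_mul hc ha
    have h₃ : 2 * M ≤ d := by nlinarith
    obtain ⟨r, rfl⟩ := hd
    omega
  · rintro ⟨h₁, h₂⟩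
    refine le_antisymm (Nat.sInf_le ?_) (lt_hmin hd hdn hM)
    obtain ⟨r, rfl⟩ := hd
    rcases (show r ≤ 2 * M by omega).lt_or_eq with hr | rfl
    · exact exists_config_of_lt hM (by omega) hr
    · have := exists_config_of_eq hM
      rwa [show 4 * M = 2 * (2 * M) by ring] at this

lemma hminN_eq {M : ℕ} (hM : 1 ≤ M) : hminN (8 * M - 1) = 2 * M + 1 := by
  refine le_antisymm (Nat.sInf_le ⟨4 * M + 1, ⟨2 * M, by ring⟩, by omega, by omega, ?_⟩) ?_
  · exact ((hmin_eq_iff hM ⟨2 * M, by ring⟩ (by omega)).2 ⟨by omega, le_rfl⟩).symm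
  · refine le_csInf ⟨_, 1, odd_one, le_rfl, by omega, rfl⟩ ?_
    rintro _ ⟨d, hd, -, hdn, rfl⟩
    exact lt_hmin hd hdn hM

/-- for `n ≡ 7 (mod 8)`: `hmin(n) = (n+5)/4`, attained exactly for odd
`d` with `(n+5)/4 ≤ d ≤ (n+3)/2`. -/
theorem stmt18 (n : ℕ) (hn : Odd n) (hnpos : 0 < n) (hmod : n % 8 = 7) :
    hminN n = (n + 5) / 4 ∧
    ∀ d : ℕ, Odd d → 1 ≤ d → d ≤ n →
      (hmin n d = hminN n ↔ ((n + 5) / 4 ≤ d ∧ d ≤ (n + 3) / 2)) := by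
  obtain ⟨M, hM, rfl⟩ : ∃ M, 1 ≤ M ∧ n = 8 * M - 1 := ⟨(n + 1) / 8, by omega, by omega⟩
  rw [hminN_eq hM]
  refine ⟨by omega, fun d hd _ hdn => ?_⟩
  rw [hmin_eq_iff hM hd hdn, show (8 * M - 1 + 5) / 4 = 2 * M + 1 by omega,
    show (8 * M - 1 + 3) / 2 = 4 * M + 1 by omega]
end
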